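/- arXiv:1909.10241 — 4 statements merged into one kernel-verified Lean document; each statement's English description precedes it below -/
import Mathlib

section
/- Let n ≥ 1 and let W ⊆ ℂ^n × (ℂ*)^n be an irreducible algebraic variety such that the projection π₁(W) of W to the first n coordinates is Zariski dense in ℂ^n. Then the set {ā ∈ ℂ^n : (ā, e^{ā}) ∈ W} is Zariski dense in ℂ^n. -/
open MvPolynomial Complex

/-- The common zero set in `ℂ^σ` of a family of polynomials. -/
def zeroSet {σ : Type} (T : Set (MvPolynomial σ ℂ)) : Set (σ → ℂ) :=
  {x | ∀ p ∈ T, eval x p = 0}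

/-- A subset of `ℂ^σ` is Zariski closed if it is the common zero set of a
family of polynomials. -/
def IsZClosed {σ : Type} (s : Set (σ → ℂ)) : Prop :=
  ∃ T : Set (MvPolynomial σ ℂ), s = zeroSet T

/-- The Zariski closure of a subset of `ℂ^σ`. -/
def zClosure {σ : Type} (s : Set (σ → ℂ)) : Set (σ → ℂ) :=
  ⋂₀ {c : Set (σ → ℂ) | IsZClosed c ∧ s ⊆ c}

/-- A subset of `ℂ^σ` is Zariski dense if the only polynomial vanishing
identically on it is the zero polynomial. -/
def IsZDense {σ : Type} (s : Set (σ → ℂ)) : Prop :=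
  ∀ p : MvPolynomial σ ℂ, (∀ x ∈ s, eval x p = 0) → p = 0

/-- A subset of `ℂ^σ` is irreducible (for the Zariski topology). -/
def IsZIrreducible {σ : Type} (s : Set (σ → ℂ)) : Prop :=
  s.Nonempty ∧ ∀ c₁ c₂ : Set (σ → ℂ), IsZClosed c₁ → IsZClosed c₂ →
    s ⊆ c₁ ∪ c₂ → s ⊆ c₁ ∨ s ⊆ c₂

/-- The dimension of a subset of `ℂ^σ`: the Krull dimension of its Zariski
closure, i.e. the Krull dimension of the poset of irreducible Zariski closed
subsets of the closure (`⊥ = -1` for the empty set). -/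
noncomputable def zdim {σ : Type} (s : Set (σ → ℂ)) : WithBot ℕ∞ :=
  Order.krullDim {t : Set (σ → ℂ) // IsZClosed t ∧ IsZIrreducible t ∧ t ⊆ zClosure s}

/-- Constructible subsets of `ℂ^σ`: finite Boolean combinations of Zariski
closed sets. -/
inductive IsZConstructible {σ : Type} : Set (σ → ℂ) → Prop
  | of_closed (s : Set (σ → ℂ)) : IsZClosed s → IsZConstructible s
  | compl (s : Set (σ → ℂ)) : IsZConstructible s → IsZConstructible sᶜ
  | union (s t : Set (σ → ℂ)) : IsZConstructible s → IsZConstructible t →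
      IsZConstructible (s ∪ t)

/-- "The transcendence degree of `K(s)` over `K` is at least `r`":
there are `r` elements of `s` that are algebraically independent over `K`. -/
def TrdegGe (K : Type) [Field K] [Algebra K ℂ] (s : Set ℂ) (r : ℕ) : Prop :=
  ∃ t : Finset ℂ, ↑t ⊆ s ∧ t.card = r ∧
    AlgebraicIndependent K (Subtype.val : ↥(t : Set ℂ) → ℂ)

/-- "The transcendence degree of `K(s)` over `K` equals `m`": there is a
transcendence basis of `K(s)` over `K` consisting of `m` elements of `s`. -/
def TrdegEq (K : Type) [Field K] [Algebra K ℂ] (s : Set ℂ) (m : ℕ) : Prop :=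
  ∃ t : Finset ℂ, ↑t ⊆ s ∧ t.card = m ∧
    AlgebraicIndependent K (Subtype.val : ↥(t : Set ℂ) → ℂ) ∧
    ∀ x ∈ s, IsAlgebraic (↥(IntermediateField.adjoin K (t : Set ℂ))) x

/-- Schanuel's Conjecture: the transcendence degree over `ℚ` of
`ℚ(z₁,…,zₙ,e^{z₁},…,e^{zₙ})` is at least the dimension of the `ℚ`-vector
space spanned by `z₁,…,zₙ`. -/
def SchanuelConjecture : Prop :=
  ∀ (n : ℕ) (z : Fin n → ℂ),
    TrdegGe ℚ (Set.range z ∪ Set.range fun i => exp (z i))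
      (Module.finrank ℚ ↥(Submodule.span ℚ (Set.range z)))

section Algebra

/-- Elements of a field algebraic over the fraction field `K` of an integrally closed domain `R`
of characteristic zero are simultaneously polynomial expressions over `R` in one integral element,
up to a common denominator; the denominator also clears the different of that element. -/
theorem exists_integral_primitive_common_denominator {R K Ω ι : Type*} [CommRing R] [IsDomain R]
    [IsIntegrallyClosed R] [Field K] [CharZero K] [Algebra R K] [IsFractionRing R K] [Field Ω]
    [Algebra K Ω] [Algebra R Ω] [IsScalarTower R K Ω] [Algebra.IsAlgebraic K Ω] [Finite ι]
    (e : ι → Ω) :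
    ∃ (β : Ω) (D : R) (Q : ι → Polynomial R) (b : Polynomial R), IsIntegral R β ∧ D ≠ 0 ∧
      (∀ i, Polynomial.aeval β (Q i) = algebraMap R Ω D * e i) ∧
      Polynomial.aeval β b * Polynomial.aeval β (Polynomial.derivative (minpoly R β)) =
        algebraMap R Ω D := by
  classical
  have hRK : Function.Injective (algebraMap R K) := IsFractionRing.injective R K
  have : FiniteDimensional K (IntermediateField.adjoin K (Set.range e)) :=
    IntermediateField.finiteDimensional_adjoin fun x _ ↦ Algebra.IsIntegral.isIntegral x
  obtain ⟨α, hα⟩ := Field.exists_primitive_element K (IntermediateField.adjoin K (Set.range e))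
  have halg : IsAlgebraic R (α : Ω) :=
    (IsFractionRing.isAlgebraic_iff R K Ω).2 (Algebra.IsAlgebraic.isAlgebraic _)
  obtain ⟨r, hr, hint⟩ := halg.exists_integral_multiple
  set β : Ω := r • (α : Ω) with hβ
  have hαβ : (α : Ω) ∈ IntermediateField.adjoin K {β} := by
    have h1 : (α : Ω) = (algebraMap R K r)⁻¹ • β := by
      have h0 : algebraMap R K r ≠ 0 := by simpa using hRK.ne hr
      rw [hβ, ← algebraMap_smul K r (α : Ω), smul_smul, inv_mul_cancel₀ h0, one_smul]
    rw [h1]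
    exact IntermediateField.smul_mem _ (IntermediateField.mem_adjoin_simple_self K β)
  have hle : IntermediateField.adjoin K (Set.range e) ≤ IntermediateField.adjoin K {β} := by
    have h := congrArg IntermediateField.lift hα
    rw [IntermediateField.lift_top, IntermediateField.lift_adjoin_simple] at h
    rw [← h]
    exact IntermediateField.adjoin_simple_le_iff.2 hαβ
  have hpoly : ∀ x ∈ IntermediateField.adjoin K {β}, ∃ (d : R) (q : Polynomial R), d ≠ 0 ∧
      Polynomial.aeval β q = algebraMap R Ω d * x := by
    intro x hx
    rw [← IntermediateField.mem_toSubalgebra,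
      IntermediateField.adjoin_simple_toSubalgebra_of_isAlgebraic
        (Algebra.IsAlgebraic.isAlgebraic β), Algebra.adjoin_singleton_eq_range_aeval] at hx
    obtain ⟨q, rfl⟩ := hx
    obtain ⟨d, hd, h⟩ := IsLocalization.integerNormalization_spec (nonZeroDivisors R) q
    refine ⟨d, IsLocalization.integerNormalization (nonZeroDivisors R) q,
      nonZeroDivisors.ne_zero hd, ?_⟩
    rw [← Polynomial.aeval_map_algebraMap K, h, Algebra.smul_def, Polynomial.algebraMap_apply,
      map_mul, Polynomial.aeval_C, IsScalarTower.algebraMap_apply R K Ω]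
    rfl
  have hder : Polynomial.aeval β (Polynomial.derivative (minpoly R β)) ≠ 0 := by
    rw [← Polynomial.aeval_map_algebraMap K, ← Polynomial.derivative_map,
      ← minpoly.isIntegrallyClosed_eq_field_fractions' K hint]
    exact (minpoly.irreducible (Algebra.IsIntegral.isIntegral β)).separable.aeval_derivative_ne_zero
      (minpoly.aeval _ _)
  let e' : Option ι → Ω := fun o ↦ o.elim
    (Polynomial.aeval β (Polynomial.derivative (minpoly R β)))⁻¹ e
  have he' : ∀ o, e' o ∈ IntermediateField.adjoin K {β} := by
    rintro (_ | i)
    · refine inv_mem ?_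
      rw [← Polynomial.aeval_map_algebraMap K]
      exact IntermediateField.algebra_adjoin_le_adjoin K _ (Polynomial.aeval_mem_adjoin_singleton _ _)
    · exact hle (IntermediateField.subset_adjoin _ _ ⟨i, rfl⟩)
  choose d q hd hq using fun o ↦ hpoly _ (he' o)
  have := Fintype.ofFinite ι
  have hQ : ∀ o, Polynomial.aeval β (Polynomial.C (∏ j ∈ Finset.univ.erase o, d j) * q o) =
      algebraMap R Ω (∏ j, d j) * e' o := by
    intro o
    rw [← Finset.prod_erase_mul _ _ (Finset.mem_univ o), map_mul, Polynomial.aeval_C, hq, map_mul,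
      mul_assoc]
  refine ⟨β, ∏ j, d j, fun i ↦ Polynomial.C (∏ j ∈ Finset.univ.erase (some i), d j) * q (some i),
    Polynomial.C (∏ j ∈ Finset.univ.erase none, d j) * q none, hint,
    Finset.prod_ne_zero_iff.2 fun o _ ↦ hd o, fun i ↦ hQ (some i), ?_⟩
  rw [hQ none]
  exact inv_mul_cancel_right₀ hder _

/-- Evaluating a polynomial in two groups of variables, viewed as a polynomial in the second group
with coefficients in the first, in two stages. -/
theorem eval₂_aeval_sumElim {k σ τ S : Type*} [CommRing k] [CommRing S] [Algebra k S]
    (g : MvPolynomial σ k →ₐ[k] S) (y : τ → S) (p : MvPolynomial (σ ⊕ τ) k) :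
    eval₂ (g : MvPolynomial σ k →+* S) y
      (aeval (Sum.elim (fun i ↦ C (X i)) X : σ ⊕ τ → MvPolynomial τ (MvPolynomial σ k)) p) =
      aeval (Sum.elim (fun i ↦ g (X i)) y) p := by
  induction p using MvPolynomial.induction_on with
  | C a => simp [MvPolynomial.algebraMap_apply]
  | add p q hp hq => simp only [map_add, eval₂_add, hp, hq]
  | mul_X p i hp =>
    rw [map_mul, eval₂_mul, hp, map_mul]
    rcases i with i | i <;> simp

/-- If polynomials over `ℂ` in two groups of variables have common zeros with nonzero second
coordinates whose first coordinates are Zariski dense, then they have a common zero with nonzero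
second coordinates that is generic in the first group of variables. -/
theorem exists_generic_zero {n : ℕ} (T : Set (MvPolynomial (Fin n ⊕ Fin n) ℂ))
    (hdom : IsZDense {x : Fin n → ℂ | ∃ v ∈ zeroSet T ∩ {v | ∀ i, v (Sum.inr i) ≠ 0},
      x = fun i => v (Sum.inl i)}) :
    ∃ y : Fin n → AlgebraicClosure (FractionRing (MvPolynomial (Fin n) ℂ)),
      (∀ i, y i ≠ 0) ∧ ∀ p ∈ T,
        aeval (Sum.elim (fun i ↦ algebraMap (MvPolynomial (Fin n) ℂ) _ (X i)) y) p = 0 := by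
  set R := MvPolynomial (Fin n) ℂ
  set K := FractionRing R
  set Ω := AlgebraicClosure K
  let ψ : MvPolynomial (Fin n ⊕ Fin n) ℂ →ₐ[ℂ] MvPolynomial (Fin n) R :=
    aeval (Sum.elim (fun i ↦ C (X i)) X)
  let ι : MvPolynomial (Fin n) R →+* MvPolynomial (Fin n) K := MvPolynomial.map (algebraMap R K)
  have hι : Function.Injective ι := MvPolynomial.map_injective _ (IsFractionRing.injective R K)
  let J : Ideal (MvPolynomial (Fin n) R) := Ideal.span (ψ '' T)
  by_contra! hcon
  have hrad : (∏ i, X i : MvPolynomial (Fin n) K) ∈ (J.map ι).radical := by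
    rw [← vanishingIdeal_zeroLocus_eq_radical (K := Ω), mem_vanishingIdeal_iff]
    intro y hy
    by_contra hne
    rw [map_prod, Finset.prod_eq_zero_iff] at hne
    push Not at hne
    obtain ⟨p, hp, hpne⟩ := hcon y fun i ↦ by simpa using hne i (Finset.mem_univ i)
    refine hpne ?_
    have := hy _ (Ideal.mem_map_of_mem ι (Ideal.subset_span ⟨p, hp, rfl⟩))
    have h := eval₂_aeval_sumElim (IsScalarTower.toAlgHom ℂ R Ω) y p
    rw [aeval_map_algebraMap] at this
    exact h.symm.trans this
  obtain ⟨N, hN⟩ := hrad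
  have hloc : (∏ i, X i : MvPolynomial (Fin n) K) ^ N =
      ι ((∏ i, X i : MvPolynomial (Fin n) R) ^ N) := by
    simp [ι]
  let := algebraMvPolynomial (σ := Fin n) (R := R) (S := K)
  rw [hloc] at hN
  obtain ⟨⟨a, s⟩, has⟩ := (IsLocalization.mem_map_algebraMap_iff
    ((nonZeroDivisors R).map (C (σ := Fin n))) (MvPolynomial (Fin n) K)).1 hN
  obtain ⟨s, r, hr, rfl⟩ := s
  have has' := hι ((map_mul ι _ _).trans has)
  refine nonZeroDivisors.ne_zero hr (hdom r ?_)
  rintro _ ⟨v, ⟨hvT, hv0⟩, rfl⟩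
  let φ : MvPolynomial (Fin n) R →+* ℂ :=
    eval₂Hom (aeval (R := ℂ) fun i ↦ v (Sum.inl i)) fun i ↦ v (Sum.inr i)
  have hφa : φ a = 0 := by
    have : J ≤ RingHom.ker φ := by
      refine Ideal.span_le.2 ?_
      rintro _ ⟨p, hp, rfl⟩
      have h := eval₂_aeval_sumElim (aeval (R := ℂ) fun i ↦ v (Sum.inl i))
        (fun i ↦ v (Sum.inr i)) p
      simp only [aeval_X] at h
      rw [show (Sum.elim (fun i ↦ v (Sum.inl i)) fun i ↦ v (Sum.inr i)) = v from
        Sum.elim_comp_inl_inr v] at h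
      exact h.trans (hvT p hp)
    exact this a.2
  have h0 := congrArg φ has'
  rw [hφa, map_mul, map_pow, map_prod] at h0
  have hX : ∏ i, φ (X i) ≠ 0 := Finset.prod_ne_zero_iff.2 fun i _ ↦ by simpa [φ] using hv0 i
  have hr0 := (mul_eq_zero.1 h0).resolve_left (pow_ne_zero _ hX)
  simp only [φ, coe_eval₂Hom, eval₂_C] at hr0
  exact hr0

/-- Substituting fractions `Q i / D` into a polynomial and clearing denominators. -/
theorem exists_clear_denominators {k σ τ : Type*} [CommRing k] (D : MvPolynomial σ k)
    (Q : τ → Polynomial (MvPolynomial σ k)) (p : MvPolynomial (σ ⊕ τ) k) :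
    ∃ (N : ℕ) (G : Polynomial (MvPolynomial σ k)), ∀ {S : Type} [CommRing S] [Algebra k S]
      (g : Polynomial (MvPolynomial σ k) →ₐ[k] S) (y : τ → S),
      (∀ i, g (Q i) = g (Polynomial.C D) * y i) →
      g G = g (Polynomial.C D) ^ N *
        aeval (Sum.elim (fun i ↦ g (Polynomial.C (X i))) y) p := by
  induction p using MvPolynomial.induction_on with
  | C a =>
    refine ⟨0, algebraMap k _ a, fun g y _ ↦ ?_⟩
    rw [AlgHom.commutes, algHom_C, pow_zero, one_mul]
  | add p q hp hq =>
    obtain ⟨N, G, hG⟩ := hp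
    obtain ⟨N', G', hG'⟩ := hq
    refine ⟨N + N', Polynomial.C D ^ N' * G + Polynomial.C D ^ N * G', fun g y h ↦ ?_⟩
    rw [map_add, map_mul, map_mul, map_pow, map_pow, hG g y h, hG' g y h, map_add]
    ring
  | mul_X p i hp =>
    obtain ⟨N, G, hG⟩ := hp
    rcases i with i | i
    · refine ⟨N, G * Polynomial.C (X i), fun g y h ↦ ?_⟩
      rw [map_mul, map_mul, hG g y h, aeval_X, Sum.elim_inl, mul_assoc]
    · refine ⟨N + 1, G * Q i, fun g y h ↦ ?_⟩
      rw [map_mul, map_mul, hG g y h, h i, aeval_X, Sum.elim_inr]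
      ring

/-- Evaluation at `(x, z)` of a polynomial in one variable over the polynomial ring in `n`
variables. -/
noncomputable def fiberEval {n : ℕ} (x : Fin n → ℂ) (z : ℂ) :
    Polynomial (MvPolynomial (Fin n) ℂ) →ₐ[ℂ] ℂ :=
  Polynomial.eval₂AlgHom (aeval x) z fun _ ↦ mul_comm _ _

@[simp]
theorem fiberEval_C {n : ℕ} (x : Fin n → ℂ) (z : ℂ) (r : MvPolynomial (Fin n) ℂ) :
    fiberEval x z (Polynomial.C r) = eval x r :=
  Polynomial.eval₂_C _ _

@[simp]
theorem fiberEval_X {n : ℕ} (x : Fin n → ℂ) (z : ℂ) :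
    fiberEval x z Polynomial.X = z :=
  Polynomial.eval₂_X _ _

/-- A zero set with nonzero second coordinates that dominates the space of first coordinates
contains the graph of an algebraic function, given by rational expressions in a simple root of a
monic polynomial away from the zeros of a polynomial `D`. -/
theorem exists_algebraic_section {n : ℕ} (T : Set (MvPolynomial (Fin n ⊕ Fin n) ℂ))
    (hdom : IsZDense {x : Fin n → ℂ | ∃ v ∈ zeroSet T ∩ {v | ∀ i, v (Sum.inr i) ≠ 0},
      x = fun i => v (Sum.inl i)}) :
    ∃ (m : Polynomial (MvPolynomial (Fin n) ℂ)) (Q Q' : Fin n → Polynomial (MvPolynomial (Fin n) ℂ))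
      (D : MvPolynomial (Fin n) ℂ), m.Monic ∧ 0 < m.natDegree ∧ D ≠ 0 ∧
      ∀ x z, eval x D ≠ 0 → fiberEval x z m = 0 →
        fiberEval x z (Polynomial.derivative m) ≠ 0 ∧
        (∀ i, fiberEval x z (Q i) * fiberEval x z (Q' i) = eval x D ^ 2) ∧
        Sum.elim x (fun i ↦ fiberEval x z (Q i) / eval x D) ∈ zeroSet T := by
  set R := MvPolynomial (Fin n) ℂ
  set K := FractionRing R
  set Ω := AlgebraicClosure K
  obtain ⟨y, hy0, hy⟩ := exists_generic_zero T hdom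
  have : CharZero K := charZero_of_injective_algebraMap (IsFractionRing.injective R K)
  have : Module.IsTorsionFree R Ω := .trans_faithfulSMul R K Ω
  have : IsIntegrallyClosed R := inferInstance
  obtain ⟨β, D, Q, b, hβ, hD, hQ, hb⟩ := exists_integral_primitive_common_denominator
    (R := R) (K := K) (Sum.elim y fun i ↦ (y i)⁻¹)
  have hdvd : ∀ G : Polynomial R, Polynomial.aeval β G = 0 → ∀ x z,
      fiberEval x z (minpoly R β) = 0 → fiberEval x z G = 0 := by
    intro G hG x z hz
    obtain ⟨H, rfl⟩ := minpoly.isIntegrallyClosed_dvd hβ hG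
    rw [map_mul, hz, zero_mul]
  refine ⟨minpoly R β, fun i ↦ Q (Sum.inl i), fun i ↦ Q (Sum.inr i), D, minpoly.monic hβ,
    minpoly.natDegree_pos hβ, hD, fun x z hx hz ↦ ⟨fun h0 ↦ ?_, fun i ↦ ?_, fun p hp ↦ ?_⟩⟩
  · have := hdvd (b * Polynomial.derivative (minpoly R β) - Polynomial.C D)
      (by rw [map_sub, map_mul, hb, Polynomial.aeval_C, sub_self]) x z hz
    rw [map_sub, map_mul, h0, mul_zero, zero_sub, neg_eq_zero, fiberEval_C] at this
    exact hx this
  · have := hdvd (Q (Sum.inl i) * Q (Sum.inr i) - Polynomial.C (D ^ 2)) (by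
      rw [map_sub, map_mul, hQ, hQ, Polynomial.aeval_C, map_pow, Sum.elim_inl, Sum.elim_inr,
        mul_mul_mul_comm, mul_inv_cancel₀ (hy0 i)]
      ring) x z hz
    rwa [map_sub, map_mul, fiberEval_C, sub_eq_zero, map_pow] at this
  · obtain ⟨N, G, hG⟩ := exists_clear_denominators D (fun i ↦ Q (Sum.inl i)) p
    have h1 := hG ((Polynomial.aeval β).restrictScalars ℂ) y fun i ↦ by
      rw [AlgHom.restrictScalars_apply, AlgHom.restrictScalars_apply, Polynomial.aeval_C]
      exact hQ (Sum.inl i)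
    have h2 := hG (fiberEval x z) (fun i ↦ fiberEval x z (Q (Sum.inl i)) / eval x D) fun i ↦ by
      rw [fiberEval_C, mul_div_cancel₀ _ hx]
    simp only [AlgHom.restrictScalars_apply, Polynomial.aeval_C] at h1
    rw [hy p hp, mul_zero] at h1
    rw [hdvd G h1 x z hz, fiberEval_C, eq_comm, mul_eq_zero] at h2
    have h3 := h2.resolve_left (pow_ne_zero _ hx)
    simp only [fiberEval_C, eval_X] at h3
    exact h3

end Algebra

section Analysis

open Metric Set

/-- A holomorphic map on a ball whose values are small compared to the radius has a fixed point
after translating to the center. -/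
theorem exists_eq_add_of_norm_le {E : Type*} [NormedAddCommGroup E] [NormedSpace ℂ E]
    [CompleteSpace E] {g : E → E} {p : E} {r B : ℝ} (hr : 0 < r)
    (hg : DifferentiableOn ℂ g (ball p r)) (hB : ∀ x ∈ ball p r, ‖g x‖ ≤ B) (hBr : 4 * B ≤ r) :
    ∃ a ∈ ball p r, a = p + g a := by
  have hB0 : 0 ≤ B := (norm_nonneg _).trans (hB p (mem_ball_self hr))
  have hsub : closedBall p (r / 4) ⊆ ball p r := closedBall_subset_ball (by linarith)
  have hmaps : MapsTo (fun x ↦ p + g x) (closedBall p (r / 4)) (closedBall p (r / 4)) := by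
    intro x hx
    rw [mem_closedBall, dist_eq_norm, add_sub_cancel_left]
    linarith [hB x (hsub hx)]
  have hlip : ∀ x ∈ closedBall p (r / 4), ∀ y ∈ closedBall p (r / 4),
      dist (g x) (g y) ≤ (2 / 3 : NNReal) * dist x y := by
    intro x hx y hy
    rw [mem_closedBall] at hx hy
    have hyr : ball y (3 * r / 4) ⊆ ball p r := ball_subset_ball' (by linarith)
    have hxy : x ∈ ball y (3 * r / 4) := by
      rw [mem_ball]
      linarith [dist_triangle_right x y p]
    refine (dist_le_div_mul_dist_of_mapsTo_ball (R₂ := 2 * B) (hg.mono hyr) (fun w hw ↦ ?_)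
      hxy).trans ?_
    · rw [mem_closedBall, dist_eq_norm]
      refine (norm_sub_le _ _).trans ?_
      linarith [hB w (hyr hw), hB y (hyr (mem_ball_self (by linarith)))]
    · refine mul_le_mul_of_nonneg_right ?_ dist_nonneg
      rw [div_le_iff₀ (by linarith)]
      push_cast
      linarith
  have hK : ContractingWith (2 / 3) (hmaps.restrict _ _ _) := by
    refine ⟨by rw [← NNReal.coe_lt_coe]; norm_num, LipschitzWith.of_dist_le_mul fun x y ↦ ?_⟩
    rw [Subtype.dist_eq, Subtype.dist_eq, MapsTo.val_restrict_apply, MapsTo.val_restrict_apply,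
      dist_add_left]
    exact hlip x x.2 y y.2
  obtain ⟨a, ha, hfix, -⟩ := hK.exists_fixedPoint' isClosed_closedBall.isComplete hmaps
    (mem_closedBall_self (by linarith)) (edist_ne_top _ _)
  exact ⟨a, hsub ha, hfix.symm⟩

/-- The Borel–Carathéodory theorem on a ball of a normed space, at half the radius. -/
theorem norm_le_of_re_le {E : Type*} [NormedAddCommGroup E] [NormedSpace ℂ E] {h : E → ℂ}
    {p x : E} {R A : ℝ} (hA : 0 < A) (hh : DifferentiableOn ℂ h (ball p R))
    (hre : ∀ x ∈ ball p R, (h x).re ≤ A) (hx : x ∈ ball p (R / 2)) :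
    ‖h x‖ ≤ 2 * A + 3 * ‖h p‖ := by
  have hmaps : MapsTo (fun w : ℂ ↦ p + w • (x - p)) (ball 0 2) (ball p R) := by
    intro w hw
    rw [mem_ball, dist_eq_norm] at hx
    rw [mem_ball_zero_iff] at hw
    rw [mem_ball, dist_eq_norm, add_sub_cancel_left, norm_smul]
    nlinarith [norm_nonneg (x - p), norm_nonneg w]
  have := borelCaratheodory (f := fun w : ℂ ↦ h (p + w • (x - p))) (z := 1) hA
    (hh.comp (by fun_prop) hmaps) (fun w hw ↦ hre _ (hmaps hw)) two_pos (by simp)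
  simp only [norm_one, one_smul, zero_smul, add_zero, add_sub_cancel] at this
  norm_num at this
  linarith

/-- A continuous local lift of a differentiable map along a map with invertible strict derivative
is differentiable. -/
theorem HasStrictFDerivAt.differentiableAt_of_comp {E F G : Type*} [NormedAddCommGroup E]
    [NormedSpace ℂ E] [NormedAddCommGroup F] [NormedSpace ℂ F] [CompleteSpace E]
    [NormedAddCommGroup G] [NormedSpace ℂ G] {f : E → F} {f' : E ≃L[ℂ] F} {s : G → E} {x : G}
    (hf : HasStrictFDerivAt f (f' : E →L[ℂ] F) (s x)) (hs : ContinuousAt s x)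
    (hfs : DifferentiableAt ℂ (fun y ↦ f (s y)) x) : DifferentiableAt ℂ s x := by
  have h1 : DifferentiableAt ℂ (fun y ↦ hf.localInverse f f' (s x) (f (s y))) x :=
    DifferentiableAt.comp x hf.to_localInverse.differentiableAt hfs
  exact h1.congr_of_eventuallyEq
    ((hs.eventually hf.eventually_left_inverse).mono fun y hy ↦ hy.symm)

theorem isSimplyConnected_ball {E : Type*} [NormedAddCommGroup E] [NormedSpace ℝ E] {p : E} {R : ℝ}
    (hR : 0 < R) : IsSimplyConnected (ball p R) := by
  have := (convex_ball p R).contractibleSpace ⟨p, mem_ball_self hR⟩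
  exact SimplyConnectedSpace.ofContractible _

/-- A nonvanishing holomorphic function on a ball has a holomorphic logarithm, with prescribed
principal value at the center. -/
theorem exists_differentiableOn_log {E : Type*} [NormedAddCommGroup E] [NormedSpace ℂ E]
    {f : E → ℂ} {p : E} {R : ℝ} (hR : 0 < R)
    (hf : DifferentiableOn ℂ f (ball p R)) (hf0 : ∀ x ∈ ball p R, f x ≠ 0) :
    ∃ g : E → ℂ, DifferentiableOn ℂ g (ball p R) ∧ (∀ x ∈ ball p R, exp (g x) = f x) ∧
      g p = log (f p) := by
  have := NormedSpace.restrictScalars ℝ ℂ E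
  obtain ⟨g, hgc, hg⟩ := exists_continuousOn_eqOn_exp_comp (isSimplyConnected_ball hR) isOpen_ball
    hf.continuousOn (by rintro ⟨x, hx, h0⟩; exact hf0 x hx h0)
  have hp : p ∈ ball p R := mem_ball_self hR
  have hgd : DifferentiableOn ℂ g (ball p R) := fun x hx ↦ by
    have hnhds := isOpen_ball.mem_nhds hx
    refine DifferentiableAt.differentiableWithinAt ?_
    refine HasStrictFDerivAt.differentiableAt_of_comp
      ((hasStrictDerivAt_exp (g x)).hasStrictFDerivAt_equiv (exp_ne_zero _))
      (hgc.continuousAt hnhds) ?_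
    exact (hf.differentiableAt hnhds).congr_of_eventuallyEq
      (Filter.eventually_of_mem hnhds fun y hy ↦ hg hy)
  refine ⟨fun x ↦ g x - g p + log (f p), (hgd.sub_const _).add_const _, fun x hx ↦ ?_, by simp⟩
  rw [exp_add, exp_sub, exp_log (hf0 p hp), ← hg hx, ← hg hp]
  simp

/-- If `exp` is `1` at the center of a large ball, then the system `exp (a i) = f i a` has a
solution in this ball as soon as `f i` and `(f i)⁻¹` are subexponentially bounded. -/
theorem exists_exp_eq_of_norm_le {ι : Type*} [Fintype ι] {p : ι → ℂ} {R A : ℝ} (hA : 0 < A)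
    {f : (ι → ℂ) → ι → ℂ} (hp : ∀ i, exp (p i) = 1)
    (hf : ∀ i, DifferentiableOn ℂ (fun x ↦ f x i) (ball p R))
    (hle : ∀ x ∈ ball p R, ∀ i, ‖f x i‖ ≤ Real.exp A)
    (hge : ∀ x ∈ ball p R, ∀ i, Real.exp (-A) ≤ ‖f x i‖)
    (hR : 8 * (5 * A + 3 * Real.pi) ≤ R) :
    ∃ a ∈ ball p R, ∀ i, exp (a i) = f a i := by
  have hR0 : 0 < R := by linarith [Real.pi_pos]
  have hpR : p ∈ ball p R := mem_ball_self hR0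
  have hf0 : ∀ x ∈ ball p R, ∀ i, f x i ≠ 0 := fun x hx i ↦
    norm_pos_iff.1 ((Real.exp_pos _).trans_le (hge x hx i))
  choose g hgd hg hgp using fun i ↦ exists_differentiableOn_log hR0 (hf i) fun x hx ↦ hf0 x hx i
  have hre : ∀ i, ∀ x ∈ ball p R, |(g i x).re| ≤ A := fun i x hx ↦ by
    have h1 := hle x hx i
    have h2 := hge x hx i
    rw [← hg i x hx, norm_exp, Real.exp_le_exp] at h1 h2
    exact abs_le.2 ⟨h2, h1⟩
  have hgp' : ∀ i, ‖g i p‖ ≤ A + Real.pi := fun i ↦ by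
    refine (norm_le_abs_re_add_abs_im _).trans (add_le_add (hre i p hpR) ?_)
    rw [hgp i, log_im]
    exact abs_arg_le_pi _
  have hsub : ball p (R / 2) ⊆ ball p R := ball_subset_ball (by linarith)
  obtain ⟨a, ha, hfix⟩ := exists_eq_add_of_norm_le (g := fun x i ↦ g i x) (half_pos hR0)
    (differentiableOn_pi.2 fun i ↦ (hgd i).mono hsub) (B := 5 * A + 3 * Real.pi)
    (fun x hx ↦ (pi_norm_le_iff_of_nonneg (by positivity)).2 fun i ↦
      (norm_le_of_re_le hA (hgd i) (fun y hy ↦ (abs_le.1 (hre i y hy)).2) hx).trans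
        (by linarith [hgp' i])) (by linarith)
  refine ⟨a, hsub ha, fun i ↦ ?_⟩
  rw [congrFun hfix i, Pi.add_apply, exp_add, hp, one_mul, hg i a (hsub ha)]

end Analysis

section AlgebraicFunctions

open Metric Set

theorem fiberEval_eq_eval_map {n : ℕ} (x : Fin n → ℂ) (z : ℂ)
    (S : Polynomial (MvPolynomial (Fin n) ℂ)) :
    fiberEval x z S = (S.map (eval x)).eval z :=
  (Polynomial.eval_map _ _).symm

theorem contDiff_fiberEval {n : ℕ} (S : Polynomial (MvPolynomial (Fin n) ℂ)) {k : WithTop ℕ∞} :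
    ContDiff ℂ k fun v : (Fin n → ℂ) × ℂ ↦ fiberEval v.1 v.2 S := by
  induction S using Polynomial.induction_on' with
  | add p q hp hq => simpa only [map_add] using hp.add hq
  | monomial j r =>
    simp only [← Polynomial.C_mul_X_pow_eq_monomial, map_mul, map_pow, fiberEval_C, fiberEval_X]
    refine ContDiff.mul ?_ (contDiff_snd.pow j)
    induction r using MvPolynomial.induction_on with
    | C a => simpa using contDiff_const
    | add p q hp hq => simpa only [map_add] using hp.add hq
    | mul_X p i hp =>
      simp only [map_mul, eval_X]
      exact hp.mul ((contDiff_apply ℂ ℂ i).comp contDiff_fst)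

theorem Polynomial.Monic.norm_le_of_eval {q : Polynomial ℂ} (hq : q.Monic) (hd : 0 < q.natDegree)
    (z : ℂ) : ‖z‖ ≤ 1 + ‖q.eval z‖ + ∑ j ∈ Finset.range q.natDegree, ‖q.coeff j‖ := by
  have hS : 0 ≤ ∑ j ∈ Finset.range q.natDegree, ‖q.coeff j‖ := by positivity
  rcases le_or_gt ‖z‖ 1 with hz | hz
  · linarith [norm_nonneg (q.eval z)]
  obtain ⟨d, hd'⟩ := Nat.exists_eq_succ_of_ne_zero hd.ne'
  have h1 := congrArg (Polynomial.eval z) hq.as_sum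
  simp only [Polynomial.eval_add, Polynomial.eval_pow, Polynomial.eval_X,
    Polynomial.eval_finsetSum, Polynomial.eval_mul, Polynomial.eval_C] at h1
  have hpow : ∀ j ∈ Finset.range q.natDegree, ‖q.coeff j * z ^ j‖ ≤ ‖q.coeff j‖ * ‖z‖ ^ d := by
    intro j hj
    rw [norm_mul, norm_pow]
    have : j ≤ d := by rw [Finset.mem_range] at hj; omega
    gcongr
    exact hz.le
  have h2 : ‖z‖ ^ (d + 1) ≤
      (‖q.eval z‖ + ∑ j ∈ Finset.range q.natDegree, ‖q.coeff j‖) * ‖z‖ ^ d := by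
    calc ‖z‖ ^ (d + 1) = ‖q.eval z - ∑ j ∈ Finset.range q.natDegree, q.coeff j * z ^ j‖ := by
          rw [h1, add_sub_cancel_right, norm_pow, hd']
      _ ≤ ‖q.eval z‖ + ∑ j ∈ Finset.range q.natDegree, ‖q.coeff j * z ^ j‖ :=
          (norm_sub_le _ _).trans (by gcongr; exact norm_sum_le _ _)
      _ ≤ ‖q.eval z‖ * ‖z‖ ^ d + ∑ j ∈ Finset.range q.natDegree, ‖q.coeff j‖ * ‖z‖ ^ d :=
          add_le_add (le_mul_of_one_le_right (norm_nonneg _) (one_le_pow₀ hz.le))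
            (Finset.sum_le_sum hpow)
      _ = _ := by rw [add_mul, Finset.sum_mul]
  rw [pow_succ, mul_comm (‖z‖ ^ d)] at h2
  linarith [le_of_mul_le_mul_right h2 (by positivity)]

theorem norm_le_of_fiberEval {n : ℕ} {m : Polynomial (MvPolynomial (Fin n) ℂ)} (hm : m.Monic)
    (hd : 0 < m.natDegree) (x : Fin n → ℂ) (z : ℂ) :
    ‖z‖ ≤ 1 + ‖fiberEval x z m‖ + ∑ j ∈ Finset.range m.natDegree, ‖eval x (m.coeff j)‖ := by
  have h := (hm.map (eval x)).norm_le_of_eval (by rwa [hm.natDegree_map]) z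
  simpa only [hm.natDegree_map, Polynomial.coeff_map, ← fiberEval_eq_eval_map] using h

/-- A monic polynomial over a space of parameters defines a proper map. -/
theorem isProperMap_prodMk_fiberEval {n : ℕ} {m : Polynomial (MvPolynomial (Fin n) ℂ)}
    (hm : m.Monic) (hd : 0 < m.natDegree) :
    IsProperMap fun v : (Fin n → ℂ) × ℂ ↦ (v.1, fiberEval v.1 v.2 m) := by
  have hc : Continuous fun v : (Fin n → ℂ) × ℂ ↦ (v.1, fiberEval v.1 v.2 m) :=
    continuous_fst.prodMk (contDiff_fiberEval m (k := 0)).continuous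
  refine isProperMap_iff_isCompact_preimage.2 ⟨hc, fun K hK ↦ ?_⟩
  obtain ⟨B, hB⟩ := hK.exists_bound_of_continuousOn (f := fun w : (Fin n → ℂ) × ℂ ↦
    (‖w.1‖ + (1 + ‖w.2‖ + ∑ j ∈ Finset.range m.natDegree, ‖eval w.1 (m.coeff j)‖) : ℝ)) (by
      refine Continuous.continuousOn ?_
      have := fun j ↦ (MvPolynomial.continuous_eval (m.coeff j)).comp
        (continuous_fst (X := Fin n → ℂ) (Y := ℂ))
      fun_prop)
  refine isCompact_of_isClosed_isBounded (hK.isClosed.preimage hc)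
    ((isBounded_closedBall (x := 0) (r := B)).subset ?_)
  rintro ⟨x, z⟩ hv
  have h1 := (le_abs_self _).trans (hB _ hv)
  have h2 := norm_le_of_fiberEval hm hd x z
  have h3 : 0 ≤ ∑ j ∈ Finset.range m.natDegree, ‖eval x (m.coeff j)‖ := by positivity
  simp only at h1
  rw [mem_closedBall_zero_iff, Prod.norm_def, max_le_iff]
  constructor <;> linarith [norm_nonneg x, norm_nonneg (fiberEval x z m)]

/-- If the vertical derivative of `φ` is nonzero then `v ↦ (v.1, φ v)` has invertible
derivative. -/
theorem HasStrictFDerivAt.exists_equiv_prodMk {G : Type*} [NormedAddCommGroup G] [NormedSpace ℂ G]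
    [CompleteSpace G] {φ : G × ℂ → ℂ} {L : G × ℂ →L[ℂ] ℂ} {v : G × ℂ}
    (h : HasStrictFDerivAt φ L v) (hL : L (0, 1) ≠ 0) :
    ∃ e : (G × ℂ) ≃L[ℂ] (G × ℂ),
      HasStrictFDerivAt (fun v ↦ (v.1, φ v)) (e : (G × ℂ) →L[ℂ] (G × ℂ)) v := by
  have hsplit : ∀ (u : G) (w : ℂ), L (u, w) = L (u, 0) + w * L (0, 1) := fun u w ↦ by
    rw [← smul_eq_mul, ← map_smul, ← map_add]
    simp
  let M := (ContinuousLinearMap.fst ℂ G ℂ).prod L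
  have hinj : M.ker = ⊥ := by
    refine LinearMap.ker_eq_bot'.2 ?_
    rintro ⟨u, w⟩ huw
    obtain ⟨hu, hw⟩ : u = 0 ∧ L (u, w) = 0 := Prod.ext_iff.1 huw
    subst hu
    rw [hsplit] at hw
    rw [Prod.mk_zero_zero, map_zero, zero_add] at hw
    simpa [hL] using hw
  have hsurj : M.range = ⊤ := by
    refine LinearMap.range_eq_top.2 ?_
    rintro ⟨u, c⟩
    refine ⟨(u, (c - L (u, 0)) / L (0, 1)), Prod.ext rfl ?_⟩
    change L (u, _) = c
    rw [hsplit, div_mul_cancel₀ _ hL, add_sub_cancel]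
  refine ⟨ContinuousLinearEquiv.ofBijective M hinj hsurj, ?_⟩
  rw [ContinuousLinearEquiv.coe_ofBijective]
  exact hasStrictFDerivAt_fst.prodMk h

/-- The map `(x, z) ↦ (x, m x z)` has invertible derivative at a simple root. -/
theorem exists_hasStrictFDerivAt_prodMk_fiberEval {n : ℕ}
    (m : Polynomial (MvPolynomial (Fin n) ℂ)) {v : (Fin n → ℂ) × ℂ}
    (hv : fiberEval v.1 v.2 (Polynomial.derivative m) ≠ 0) :
    ∃ e : ((Fin n → ℂ) × ℂ) ≃L[ℂ] ((Fin n → ℂ) × ℂ),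
      HasStrictFDerivAt (fun v : (Fin n → ℂ) × ℂ ↦ (v.1, fiberEval v.1 v.2 m))
        (e : ((Fin n → ℂ) × ℂ) →L[ℂ] ((Fin n → ℂ) × ℂ)) v := by
  have h := (contDiff_fiberEval m (k := 1)).contDiffAt.hasStrictFDerivAt (x := v) one_ne_zero
  refine h.exists_equiv_prodMk ?_
  have h1 : HasDerivAt (fun z ↦ fiberEval v.1 z m) _ v.2 :=
    HasFDerivAt.comp_hasDerivAt v.2 (f := fun z ↦ (v.1, z)) h.hasFDerivAt
      ((hasDerivAt_const v.2 v.1).prodMk (hasDerivAt_id v.2))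
  have h2 : HasDerivAt (fun z ↦ fiberEval v.1 z m) (fiberEval v.1 v.2 (Polynomial.derivative m))
      v.2 := by
    simp only [fiberEval_eq_eval_map, ← Polynomial.derivative_map]
    exact Polynomial.hasDerivAt _ _
  rwa [h1.unique h2]

/-- Over a ball on which all its roots are simple, a monic polynomial has a holomorphic root. -/
theorem exists_differentiableOn_root {n : ℕ} {m : Polynomial (MvPolynomial (Fin n) ℂ)}
    (hm : m.Monic) (hd : 0 < m.natDegree) {p : Fin n → ℂ} {R : ℝ} (hR : 0 < R)
    (hsimple : ∀ x ∈ ball p R, ∀ z, fiberEval x z m = 0 →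
      fiberEval x z (Polynomial.derivative m) ≠ 0) :
    ∃ ζ : (Fin n → ℂ) → ℂ, DifferentiableOn ℂ ζ (ball p R) ∧
      ∀ x ∈ ball p R, fiberEval x (ζ x) m = 0 := by
  classical
  let Φ : (Fin n → ℂ) × ℂ → (Fin n → ℂ) × ℂ := fun v ↦ (v.1, fiberEval v.1 v.2 m)
  have hp : p ∈ ball p R := mem_ball_self hR
  have hcov : IsCoveringMapOn Φ (ball p R ×ˢ {0}) := by
    refine (isProperMap_prodMk_fiberEval hm hd).isClosedMap.isCoveringMapOn_of_isLocalHomeomorphOn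
      ?_ ?_
    · rintro ⟨x, c⟩ ⟨-, rfl : c = 0⟩
      refine (((m.map (eval x)).rootSet_finite ℂ).image fun z ↦ (x, z)).subset ?_
      rintro ⟨x', z⟩ hz
      obtain ⟨rfl, hz⟩ : x' = x ∧ fiberEval x' z m = 0 := Prod.ext_iff.1 hz
      refine ⟨z, ?_, rfl⟩
      rw [Polynomial.mem_rootSet]
      refine ⟨(hm.map _).ne_zero, ?_⟩
      rwa [Polynomial.coe_aeval_eq_eval, ← fiberEval_eq_eval_map]
    · rintro v ⟨hv1, hv2⟩
      obtain ⟨e, he⟩ := exists_hasStrictFDerivAt_prodMk_fiberEval m (hsimple v.1 hv1 v.2 hv2)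
      exact ⟨_, he.mem_toOpenPartialHomeomorph_source, by simp⟩
  obtain ⟨z₀, hz₀⟩ : ∃ z₀, fiberEval p z₀ m = 0 := by
    simp only [fiberEval_eq_eval_map]
    refine IsAlgClosed.exists_root _ fun h ↦ hd.ne' ?_
    rw [← hm.natDegree_map (eval p)]
    exact Polynomial.natDegree_eq_of_degree_eq_some h
  have := (isSimplyConnected_ball (p := p) hR).simplyConnectedSpace
  have := (isOpen_ball (x := p) (ε := R)).locallyPathConnectedSpace
  obtain ⟨F, ⟨-, hF⟩, -⟩ := hcov.existsUnique_continuousMap_lifts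
    (⟨fun x ↦ (x.1, 0), by fun_prop⟩ : C(ball p R, (Fin n → ℂ) × ℂ)) (a₀ := ⟨p, hp⟩)
    (e₀ := (p, z₀)) (Prod.ext rfl hz₀) (fun x ↦ ⟨x.2, rfl⟩)
  let ζ : (Fin n → ℂ) → ℂ := fun x ↦ if hx : x ∈ ball p R then (F ⟨x, hx⟩).2 else 0
  have hζ : ∀ x (hx : x ∈ ball p R), F ⟨x, hx⟩ = (x, ζ x) ∧ fiberEval x (ζ x) m = 0 := by
    intro x hx
    obtain ⟨h1, h2⟩ := Prod.ext_iff.1 (congrFun hF ⟨x, hx⟩)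
    have h3 : F ⟨x, hx⟩ = (x, ζ x) := Prod.ext h1 (by simp only [ζ, dif_pos hx])
    simp only [Function.comp_apply, Φ, h3] at h2
    exact ⟨h3, h2⟩
  refine ⟨ζ, fun x hx ↦ DifferentiableAt.differentiableWithinAt ?_, fun x hx ↦ (hζ x hx).2⟩
  have hnhds := isOpen_ball.mem_nhds hx
  have hcont : ContinuousOn ζ (ball p R) := by
    rw [continuousOn_iff_continuous_domRestrict]
    refine (continuous_snd.comp F.continuous).congr fun x ↦ ?_
    exact congrArg Prod.snd (hζ x x.2).1
  obtain ⟨e, he⟩ := exists_hasStrictFDerivAt_prodMk_fiberEval m (v := (x, ζ x))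
    (hsimple x hx _ (hζ x hx).2)
  refine (HasStrictFDerivAt.differentiableAt_of_comp (s := fun y ↦ (y, ζ y)) he
    (continuousAt_id.prodMk (hcont.continuousAt hnhds)) ?_).snd
  exact (differentiableAt_id.prodMk (differentiableAt_const 0)).congr_of_eventuallyEq
    (Filter.eventually_of_mem hnhds fun y hy ↦ Prod.ext rfl (hζ y hy).2)

end AlgebraicFunctions

section Growth

open Metric Set Filter Asymptotics

theorem MvPolynomial.IsHomogeneous.eval_smul {σ k : Type*} [Fintype σ] [CommSemiring k]
    {φ : MvPolynomial σ k} {d : ℕ} (hφ : φ.IsHomogeneous d) (t : k) (w : σ → k) :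
    eval (t • w) φ = t ^ d * eval w φ := by
  rw [eval_eq', eval_eq', Finset.mul_sum]
  refine Finset.sum_congr rfl fun s hs ↦ ?_
  have hd : ∑ i, s i = d := by
    rw [← Finsupp.degree_eq_sum, Finsupp.degree_eq_weight_one]
    exact hφ (mem_support_iff.1 hs)
  simp only [Pi.smul_apply, smul_eq_mul, mul_pow, Finset.prod_mul_distrib,
    Finset.prod_pow_eq_pow_sum, hd]
  ring

theorem MvPolynomial.homogeneousComponent_totalDegree_ne_zero {σ k : Type*} [CommSemiring k]
    {q : MvPolynomial σ k} (hq : q ≠ 0) : homogeneousComponent q.totalDegree q ≠ 0 := by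
  obtain ⟨s, hs, hdeg⟩ := q.support.exists_mem_eq_sup (by simpa using hq) fun s ↦ s.sum fun _ e ↦ e
  intro h
  have h1 := coeff_homogeneousComponent q.totalDegree q s
  rw [if_pos (show s.degree = q.totalDegree from hdeg.symm), h, coeff_zero] at h1
  exact mem_support_iff.1 hs h1.symm

/-- A polynomial is bounded below on a cone, away from the origin, around every direction in which
its leading form does not vanish. -/
theorem exists_le_norm_eval_smul {n : ℕ} {q : MvPolynomial (Fin n) ℂ} {w₀ : Fin n → ℂ}
    (h : eval w₀ (homogeneousComponent q.totalDegree q) ≠ 0) :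
    ∃ r > 0, ∃ δ > 0, ∀ᶠ t : ℝ in atTop, ∀ w ∈ ball w₀ r, δ ≤ ‖eval ((t : ℂ) • w) q‖ := by
  let F : ℝ × (Fin n → ℂ) → ℂ := fun u ↦ ∑ j ∈ Finset.range (q.totalDegree + 1),
    (u.1 : ℂ) ^ (q.totalDegree - j) * eval u.2 (homogeneousComponent j q)
  have hF : Continuous F := by
    refine continuous_finsetSum _ fun j _ ↦ Continuous.mul (by fun_prop) ?_
    exact (MvPolynomial.continuous_eval _).comp continuous_snd
  have hF0 : F (0, w₀) ≠ 0 := by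
    simp only [F]
    rw [Finset.sum_range_succ, Finset.sum_eq_zero]
    · simpa using h
    · intro j hj
      have : q.totalDegree - j ≠ 0 := by rw [Finset.mem_range] at hj; omega
      simp [this]
  have hev : ∀ᶠ u in nhds (0, w₀), ‖F (0, w₀)‖ / 2 < ‖F u‖ :=
    hF.norm.continuousAt.eventually_const_lt (half_lt_self (norm_pos_iff.2 hF0))
  obtain ⟨r, hr, hball⟩ := Metric.eventually_nhds_iff_ball.1 hev
  refine ⟨r, hr, ‖F (0, w₀)‖ / 2, half_pos (norm_pos_iff.2 hF0), ?_⟩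
  filter_upwards [eventually_gt_atTop r⁻¹, eventually_ge_atTop 1] with t ht ht1 w hw
  have ht0 : 0 < t := by linarith
  have htC : (t : ℂ) ≠ 0 := by exact_mod_cast ht0.ne'
  have hfac : eval ((t : ℂ) • w) q = (t : ℂ) ^ q.totalDegree * F (t⁻¹, w) := by
    conv_lhs => rw [← sum_homogeneousComponent q, map_sum]
    simp only [F, Finset.mul_sum]
    refine Finset.sum_congr rfl fun j hj ↦ ?_
    rw [(homogeneousComponent_isHomogeneous j q).eval_smul, ← mul_assoc]
    congr 1
    have hj' : j ≤ q.totalDegree := by rw [Finset.mem_range] at hj; omega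
    rw [ofReal_inv, inv_pow, ← div_eq_mul_inv, eq_div_iff (pow_ne_zero _ htC), ← pow_add,
      Nat.add_sub_cancel' hj']
  rw [hfac, norm_mul, norm_pow, norm_real, Real.norm_of_nonneg ht0.le]
  have hmem : (t⁻¹, w) ∈ ball ((0 : ℝ), w₀) r := by
    rw [← ball_prod_same, Set.mem_prod, mem_ball, Real.dist_0_eq_abs, abs_of_pos (by positivity)]
    exact ⟨inv_lt_of_inv_lt₀ hr ht, hw⟩
  exact (hball _ hmem).le.trans (le_mul_of_one_le_left (norm_nonneg _) (one_le_pow₀ ht1))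

/-- A function algebraic over polynomials along the roots of a monic polynomial grows
polynomially. -/
theorem exists_norm_fiberEval_le {n : ℕ} {m : Polynomial (MvPolynomial (Fin n) ℂ)} (hm : m.Monic)
    (hd : 0 < m.natDegree) (S : Polynomial (MvPolynomial (Fin n) ℂ)) :
    ∃ (C : ℝ) (M : ℕ), ∀ x z, fiberEval x z m = 0 → ‖fiberEval x z S‖ ≤ C * (1 + ‖x‖) ^ M := by
  let α := {v : (Fin n → ℂ) × ℂ // fiberEval v.1 v.2 m = 0}
  let u : α → ℝ := fun a ↦ 1 + ‖a.1.1‖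
  have hu : ∀ a, 1 ≤ u a := fun a ↦ le_add_of_nonneg_right (norm_nonneg _)
  let G : (α → ℂ) → Prop := fun f ↦ ∃ M : ℕ, f =O[⊤] fun a ↦ u a ^ M
  have hmono : ∀ {M N : ℕ}, M ≤ N → (fun a ↦ u a ^ M) =O[⊤] fun a ↦ u a ^ N := fun {M N} h ↦
    isBigO_of_le _ fun a ↦ by
      rw [norm_pow, norm_pow, Real.norm_of_nonneg (zero_le_one.trans (hu a))]
      exact pow_le_pow_right₀ (hu a) h
  have hconst : ∀ c : ℂ, G fun _ ↦ c := fun c ↦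
    ⟨0, by simpa using isBigO_const_const c (one_ne_zero (α := ℝ)) _⟩
  have hadd : ∀ {f g}, G f → G g → G fun a ↦ f a + g a := by
    rintro f g ⟨M, hM⟩ ⟨N, hN⟩
    exact ⟨max M N, (hM.trans (hmono (le_max_left _ _))).add (hN.trans (hmono (le_max_right _ _)))⟩
  have hmul : ∀ {f g}, G f → G g → G fun a ↦ f a * g a := by
    rintro f g ⟨M, hM⟩ ⟨N, hN⟩
    exact ⟨M + N, by simpa only [pow_add] using hM.mul hN⟩
  have hcoeff : ∀ r : MvPolynomial (Fin n) ℂ, G fun a ↦ eval a.1.1 r := by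
    intro r
    induction r using MvPolynomial.induction_on with
    | C c => simpa using hconst c
    | add p q hp hq => simpa only [map_add] using hadd hp hq
    | mul_X p i hp =>
      simp only [map_mul, eval_X]
      refine hmul hp ⟨1, isBigO_of_le _ fun a ↦ ?_⟩
      rw [pow_one, Real.norm_of_nonneg (zero_le_one.trans (hu a))]
      linarith [norm_le_pi_norm a.1.1 i]
  have hroot : G fun a ↦ a.1.2 := by
    have hsum : G fun a ↦ ((1 + ∑ j ∈ Finset.range m.natDegree, ‖eval a.1.1 (m.coeff j)‖ : ℝ) : ℂ) := by
      push_cast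
      refine hadd (hconst 1) ?_
      induction Finset.range m.natDegree using Finset.induction_on with
      | empty => simpa using hconst 0
      | insert j s hj hs =>
        simp only [Finset.sum_insert hj]
        obtain ⟨M, hM⟩ := hcoeff (m.coeff j)
        refine hadd ⟨M, ?_⟩ hs
        exact IsBigO.of_norm_left (by simpa using hM.norm_left)
    obtain ⟨M, hM⟩ := hsum
    refine ⟨M, (isBigO_of_le _ fun a ↦ ?_).trans hM⟩
    have h := norm_le_of_fiberEval hm hd a.1.1 a.1.2
    rw [a.2, norm_zero, add_zero] at h
    rw [norm_real]
    exact h.trans (le_abs_self _)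
  have hall : G fun a ↦ fiberEval a.1.1 a.1.2 S := by
    induction S using Polynomial.induction_on with
    | C r => simpa using hcoeff r
    | add p q hp hq => simpa only [map_add] using hadd hp hq
    | monomial j r h =>
      simp only [pow_succ, ← mul_assoc, map_mul _ _ Polynomial.X, fiberEval_X]
      exact hmul h hroot
  obtain ⟨M, hM⟩ := hall
  obtain ⟨C, hC⟩ := isBigO_top.1 hM
  refine ⟨C, M, fun x z h ↦ (hC ⟨(x, z), h⟩).trans_eq ?_⟩
  rw [norm_pow, Real.norm_of_nonneg (zero_le_one.trans (hu _))]

theorem exists_forall_norm_fiberEval_le {n : ℕ} {ι : Type*} [Finite ι]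
    {m : Polynomial (MvPolynomial (Fin n) ℂ)} (hm : m.Monic) (hd : 0 < m.natDegree)
    (S : ι → Polynomial (MvPolynomial (Fin n) ℂ)) :
    ∃ (C : ℝ) (M : ℕ), ∀ x z, fiberEval x z m = 0 →
      ∀ i, ‖fiberEval x z (S i)‖ ≤ C * (1 + ‖x‖) ^ M := by
  choose C M h using fun i ↦ exists_norm_fiberEval_le hm hd (S i)
  obtain ⟨C', hC'⟩ := Finite.exists_le C
  obtain ⟨M', hM'⟩ := Finite.exists_le M
  refine ⟨max C' 0, M', fun x z hz i ↦ (h i x z hz).trans ?_⟩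
  gcongr
  · exact (hC' i).trans (le_max_left _ _)
  · exact le_add_of_nonneg_right (norm_nonneg _)
  · exact hM' i

theorem eventually_add_mul_log_le (a b : ℝ) {r : ℝ} (hr : 0 < r) :
    ∀ᶠ t : ℝ in atTop, a + b * Real.log t ≤ r * t := by
  have h := ((isLittleO_const_id_atTop a).add (Real.isLittleO_log_id_atTop.const_mul_left b)).def hr
  filter_upwards [h, eventually_ge_atTop 0] with t ht ht0
  rw [id, Real.norm_of_nonneg ht0] at ht
  exact (le_abs_self _).trans ht

end Growth

section Density

theorem exists_int_eval_ne_zero {n : ℕ} {q : MvPolynomial (Fin n) ℂ} (hq : q ≠ 0) :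
    ∃ v : Fin n → ℤ, eval (fun i ↦ v i * (2 * Real.pi * I)) q ≠ 0 := by
  by_contra! h
  have hinj : Function.Injective fun k : ℤ ↦ (k : ℂ) * (2 * Real.pi * I) := fun a b hab ↦ by
    exact_mod_cast mul_right_cancel₀ two_pi_I_ne_zero hab
  refine hq (funext_set (fun _ ↦ Set.range fun k : ℤ ↦ (k : ℂ) * (2 * Real.pi * I))
    (fun _ ↦ Set.infinite_range_of_injective hinj) fun x hx ↦ ?_)
  choose v hv using fun i ↦ hx i (Set.mem_univ i)
  rw [map_zero, ← h v]
  exact congrArg (fun y ↦ eval y q) (funext fun i ↦ (hv i).symm)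

/-- There are balls centered at points of the kernel of `exp`, of radius proportional to the
distance to the origin, on which a given nonzero polynomial is bounded below. -/
theorem exists_ball_le_norm_eval {n : ℕ} {q : MvPolynomial (Fin n) ℂ} (hq : q ≠ 0) :
    ∃ δ > 0, ∃ B > 0, ∃ r > 0, ∀ᶠ k : ℕ in Filter.atTop, ∃ p : Fin n → ℂ,
      (∀ i, exp (p i) = 1) ∧
      ∀ x ∈ Metric.ball p (r * k), δ ≤ ‖eval x q‖ ∧ 1 + ‖x‖ ≤ B * k := by
  obtain ⟨v, hv⟩ := exists_int_eval_ne_zero (homogeneousComponent_totalDegree_ne_zero hq)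
  obtain ⟨r, hr, δ, hδ, hlow⟩ := exists_le_norm_eval_smul hv
  set w₀ : Fin n → ℂ := fun i ↦ v i * (2 * Real.pi * I)
  refine ⟨δ, hδ, 1 + ‖w₀‖ + r, by positivity, r, hr, ?_⟩
  filter_upwards [tendsto_natCast_atTop_atTop.eventually hlow, Filter.eventually_ge_atTop 1]
    with k hk hk1
  have ht1 : (1 : ℝ) ≤ k := by exact_mod_cast hk1
  have ht0 : (0 : ℝ) < k := by linarith
  have hnorm : ∀ x : Fin n → ℂ, ‖((k : ℝ) : ℂ) • x‖ = k * ‖x‖ := fun x ↦ by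
    rw [norm_smul, norm_real, Real.norm_of_nonneg ht0.le]
  refine ⟨((k : ℝ) : ℂ) • w₀, fun i ↦ exp_eq_one_iff.2 ⟨k * v i, by simp [w₀, mul_assoc]⟩, ?_⟩
  intro x hx
  obtain ⟨w, rfl⟩ : ∃ w, ((k : ℝ) : ℂ) • w = x :=
    ⟨_, smul_inv_smul₀ (by exact_mod_cast ht0.ne') x⟩
  rw [Metric.mem_ball, dist_eq_norm, ← smul_sub, hnorm, mul_comm] at hx
  have hw : ‖w - w₀‖ < r := lt_of_mul_lt_mul_right hx ht0.le
  refine ⟨hk w (by rwa [Metric.mem_ball, dist_eq_norm]), ?_⟩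
  have h1 := norm_le_norm_add_norm_sub w₀ w
  rw [norm_sub_rev] at h1
  rw [hnorm]
  nlinarith

/-- The fractions `S / D` grow polynomially wherever `D * P` is bounded below. -/
theorem norm_div_le_of_le_norm {n M : ℕ} {D P : MvPolynomial (Fin n) ℂ}
    {S : Polynomial (MvPolynomial (Fin n) ℂ)} {x : Fin n → ℂ} {z : ℂ} {δ B C t : ℝ} (hδ : 0 < δ)
    (hlow : δ ≤ ‖eval x (D * P)‖) (hx : 1 + ‖x‖ ≤ B * t)
    (hS : ‖fiberEval x z (S * Polynomial.C P)‖ ≤ C * (1 + ‖x‖) ^ M) :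
    ‖fiberEval x z S / eval x D‖ ≤ C * B ^ M / δ * t ^ M := by
  have hC0 : 0 ≤ C := nonneg_of_mul_nonneg_left ((norm_nonneg _).trans hS) (by positivity)
  rw [map_mul, norm_mul] at hlow
  have hD : 0 < ‖eval x D‖ := pos_of_mul_pos_left (hδ.trans_le hlow) (norm_nonneg _)
  rw [map_mul, fiberEval_C, norm_mul] at hS
  calc ‖fiberEval x z S / eval x D‖ ≤ C * (1 + ‖x‖) ^ M / δ := by
        rw [norm_div, div_le_div_iff₀ hD hδ]
        calc ‖fiberEval x z S‖ * δ
            ≤ ‖fiberEval x z S‖ * (‖eval x D‖ * ‖eval x P‖) := by gcongr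
          _ = ‖fiberEval x z S‖ * ‖eval x P‖ * ‖eval x D‖ := by ring
          _ ≤ _ := by gcongr
    _ ≤ C * (B * t) ^ M / δ := by gcongr
    _ = C * B ^ M / δ * t ^ M := by ring

theorem differentiableOn_fiberEval {n : ℕ} {s : Set (Fin n → ℂ)} {ζ : (Fin n → ℂ) → ℂ}
    (hζ : DifferentiableOn ℂ ζ s) (S : Polynomial (MvPolynomial (Fin n) ℂ)) :
    DifferentiableOn ℂ (fun x ↦ fiberEval x (ζ x) S) s := by
  have h : Differentiable ℂ fun w : (Fin n → ℂ) × ℂ ↦ fiberEval w.1 w.2 S :=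
    (contDiff_fiberEval S (k := 1)).differentiable one_ne_zero
  have h2 : DifferentiableOn ℂ (fun x ↦ (x, ζ x)) s := by fun_prop
  fun_prop

theorem differentiableOn_div {n : ℕ} {s : Set (Fin n → ℂ)} {f g : (Fin n → ℂ) → ℂ}
    (hf : DifferentiableOn ℂ f s) (hg : DifferentiableOn ℂ g s) (h0 : ∀ x ∈ s, g x ≠ 0) :
    DifferentiableOn ℂ (fun x ↦ f x / g x) s := by
  simp only [div_eq_mul_inv]
  exact hf.fun_mul (hg.inv h0)

/-- The graph of an algebraic function with values in the torus contains a point of the graph of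
`exp` at which a given nonzero polynomial does not vanish. -/
theorem exists_exp_eq_fiberEval_div {n : ℕ} {m : Polynomial (MvPolynomial (Fin n) ℂ)}
    (hm : m.Monic) (hd : 0 < m.natDegree) {Q Q' : Fin n → Polynomial (MvPolynomial (Fin n) ℂ)}
    {D P : MvPolynomial (Fin n) ℂ} (hD : D ≠ 0) (hP : P ≠ 0)
    (hsimple : ∀ x z, eval x D ≠ 0 → fiberEval x z m = 0 →
      fiberEval x z (Polynomial.derivative m) ≠ 0)
    (hQ : ∀ x z, eval x D ≠ 0 → fiberEval x z m = 0 →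
      ∀ i, fiberEval x z (Q i) * fiberEval x z (Q' i) = eval x D ^ 2) :
    ∃ a z, eval a D ≠ 0 ∧ eval a P ≠ 0 ∧ fiberEval a z m = 0 ∧
      ∀ i, exp (a i) = fiberEval a z (Q i) / eval a D := by
  obtain ⟨δ, hδ, B, hB, r, hr, hball⟩ := exists_ball_le_norm_eval (mul_ne_zero hD hP)
  obtain ⟨C, M, hC⟩ := exists_forall_norm_fiberEval_le hm hd
    (Sum.elim (fun i ↦ Q i * Polynomial.C P) fun i ↦ Q' i * Polynomial.C P)
  set K : ℝ := max 2 (C * B ^ M / δ)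
  have hK : 0 < K := two_pos.trans_le (le_max_left _ _)
  obtain ⟨k, ⟨p, hp, hk⟩, hk1, hkr⟩ := (hball.and
    (tendsto_natCast_atTop_atTop.eventually ((Filter.eventually_ge_atTop (1 : ℝ)).and
      (eventually_add_mul_log_le (8 * (5 * Real.log K + 3 * Real.pi)) (40 * M) hr)))).exists
  have ht0 : (0 : ℝ) < k := by linarith
  have hDP : ∀ x ∈ Metric.ball p (r * k), eval x D ≠ 0 ∧ eval x P ≠ 0 := fun x hx ↦ by
    rw [← mul_ne_zero_iff, ← map_mul, ← norm_pos_iff]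
    exact hδ.trans_le (hk x hx).1
  obtain ⟨ζ, hζd, hζ⟩ := exists_differentiableOn_root hm hd (mul_pos hr ht0)
    fun x hx z hz ↦ hsimple x z (hDP x hx).1 hz
  have hdiff : ∀ S, DifferentiableOn ℂ (fun x ↦ fiberEval x (ζ x) S) (Metric.ball p (r * k)) :=
    differentiableOn_fiberEval hζd
  set A := Real.log K + M * Real.log k
  have hA : Real.exp A = K * k ^ M := by
    rw [Real.exp_add, Real.exp_log hK, Real.exp_nat_mul, Real.exp_log ht0]
  have hA0 : 0 < A :=
    add_pos_of_pos_of_nonneg (Real.log_pos (one_lt_two.trans_le (le_max_left _ _)))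
      (mul_nonneg M.cast_nonneg (Real.log_nonneg hk1))
  have hbound : ∀ x ∈ Metric.ball p (r * k), ∀ S,
      ‖fiberEval x (ζ x) (S * Polynomial.C P)‖ ≤ C * (1 + ‖x‖) ^ M →
      ‖fiberEval x (ζ x) S / eval x D‖ ≤ Real.exp A := fun x hx S hS ↦ by
    rw [hA]
    refine (norm_div_le_of_le_norm hδ (hk x hx).1 (hk x hx).2 hS).trans ?_
    gcongr
    exact le_max_right _ _
  have hupper : ∀ x ∈ Metric.ball p (r * k), ∀ i,
      ‖fiberEval x (ζ x) (Q i) / eval x D‖ ≤ Real.exp A := fun x hx i ↦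
    hbound x hx _ (hC x _ (hζ x hx) (Sum.inl i))
  have hlower : ∀ x ∈ Metric.ball p (r * k), ∀ i,
      Real.exp (-A) ≤ ‖fiberEval x (ζ x) (Q i) / eval x D‖ := fun x hx i ↦ by
    have h1 := hbound x hx _ (hC x _ (hζ x hx) (Sum.inr i))
    have hDx := (hDP x hx).1
    have h2 : fiberEval x (ζ x) (Q i) / eval x D * (fiberEval x (ζ x) (Q' i) / eval x D) = 1 := by
      rw [div_mul_div_comm, hQ x _ hDx (hζ x hx) i, ← sq, div_self (pow_ne_zero 2 hDx)]
    rw [eq_inv_of_mul_eq_one_left h2, Real.exp_neg, norm_inv]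
    exact inv_anti₀ (norm_pos_iff.2 (right_ne_zero_of_mul_eq_one h2)) h1
  obtain ⟨a, ha, hexp⟩ := exists_exp_eq_of_norm_le hA0 hp
    (f := fun x i ↦ fiberEval x (ζ x) (Q i) / eval x D)
    (fun i ↦ differentiableOn_div (hdiff (Q i))
      (by simpa only [fiberEval_C] using hdiff (Polynomial.C D)) fun x hx ↦ (hDP x hx).1)
    hupper hlower (by linarith)
  exact ⟨a, ζ a, (hDP a ha).1, (hDP a ha).2, hζ a ha, hexp⟩

end Density

/-- for an irreducible algebraic variety `W ⊆ ℂ^n × (ℂ*)^n` whose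
projection to the first `n` coordinates is Zariski dense in `ℂ^n`, the set
`{ā ∈ ℂ^n : (ā, e^ā) ∈ W}` is Zariski dense in `ℂ^n`. -/
theorem exp_points_dense_of_dominant_first_projection (n : ℕ) (hn : 1 ≤ n)
    (W : Set (Fin n ⊕ Fin n → ℂ))
    (hW : ∃ T : Set (MvPolynomial (Fin n ⊕ Fin n) ℂ),
      W = zeroSet T ∩ {v | ∀ i, v (Sum.inr i) ≠ 0})
    (hWirr : IsZIrreducible W)
    (hdom : IsZDense {x : Fin n → ℂ | ∃ v ∈ W, x = fun i => v (Sum.inl i)}) :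
    IsZDense {a : Fin n → ℂ | Sum.elim a (fun i => exp (a i)) ∈ W} := by
  obtain ⟨T, rfl⟩ := hW
  obtain ⟨m, Q, Q', D, hm, hd, hD, hsec⟩ := exists_algebraic_section T hdom
  intro P hP
  by_contra hP0
  obtain ⟨a, z, haD, haP, haz, hexp⟩ := exists_exp_eq_fiberEval_div hm hd hD hP0
    (fun x z hx hz ↦ (hsec x z hx hz).1) fun x z hx hz ↦ (hsec x z hx hz).2.1
  refine haP (hP a ⟨?_, fun i ↦ exp_ne_zero _⟩)
  simpa only [hexp] using (hsec a z haD haz).2.2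
end

section
/- Let m ≥ 0 and let P : ℂ^{1+m} → ℂ be an exponential polynomial function, i.e. a member of the smallest class of functions ℂ^{1+m} → ℂ containing the coordinate projections and the constant functions with values in ℂ, and closed under addition, multiplication, and composition with the complex exponential function. Let X = {x ∈ ℂ : there exists ȳ ∈ ℂ^m with P(x, ȳ) = 0}. Then either X is countable or ℂ \ X is countable. -/
open MvPolynomial Complex

/-- Exponential polynomial functions `ℂ^k → ℂ`: the smallest class of functions
containing coordinate projections and constants, and closed under addition,
multiplication and composition with the complex exponential. -/
inductive IsExpPoly {k : ℕ} : ((Fin k → ℂ) → ℂ) → Prop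
  | proj (i : Fin k) : IsExpPoly fun x => x i
  | const (c : ℂ) : IsExpPoly fun _ => c
  | add {f g : (Fin k → ℂ) → ℂ} : IsExpPoly f → IsExpPoly g →
      IsExpPoly fun x => f x + g x
  | mul {f g : (Fin k → ℂ) → ℂ} : IsExpPoly f → IsExpPoly g →
      IsExpPoly fun x => f x * g x
  | exp {f : (Fin k → ℂ) → ℂ} : IsExpPoly f → IsExpPoly fun x => Complex.exp (f x)

/-- The growth scale `exp^[n] (C * log (r + 2))`. -/
noncomputable def growthBound (n : ℕ) (C r : ℝ) : ℝ :=
  Real.exp^[n] (C * Real.log (r + 2))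

/-- `f` is entire and `‖f z‖ ≤ exp^[n + 1] (C * log (‖z‖ + 2))` for some `C`. For `n = 0` these are
the entire functions of polynomial growth. -/
def HasGrowth (n : ℕ) (f : ℂ → ℂ) : Prop :=
  Differentiable ℂ f ∧ ∃ C, 0 ≤ C ∧ ∀ z, ‖f z‖ ≤ Real.exp (growthBound n C ‖z‖)

lemma growthBound_zero (C r : ℝ) : growthBound 0 C r = C * Real.log (r + 2) := rfl

lemma growthBound_succ (n : ℕ) (C r : ℝ) :
    growthBound (n + 1) C r = Real.exp (growthBound n C r) :=
  Function.iterate_succ_apply' _ _ _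

lemma growthBound_nonneg (n : ℕ) {C r : ℝ} (hC : 0 ≤ C) (hr : 0 ≤ r) :
    0 ≤ growthBound n C r := by
  cases n with
  | zero => exact mul_nonneg hC (Real.log_nonneg (by linarith))
  | succ n => rw [growthBound_succ]; positivity

lemma growthBound_mono (n : ℕ) {C C' r r' : ℝ} (hC : 0 ≤ C) (hCC' : C ≤ C') (hr : 0 ≤ r)
    (hrr' : r ≤ r') : growthBound n C r ≤ growthBound n C' r' := by
  induction n with
  | zero =>
    simp only [growthBound_zero]
    have := Real.log_nonneg (show (1 : ℝ) ≤ r + 2 by linarith)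
    gcongr
    linarith
  | succ n ih => simpa only [growthBound_succ, Real.exp_le_exp] using ih

lemma exists_le_growthBound (n : ℕ) {C A : ℝ} (hC : 0 ≤ C) (hA : 1 ≤ A) :
    ∃ C', 0 ≤ C' ∧ ∀ r, 0 ≤ r → A * growthBound n C (A * r + A) + A ≤ growthBound n C' r := by
  induction n generalizing A with
  | zero =>
    have hl : 0 ≤ Real.log (A + 1) := Real.log_nonneg (by linarith)
    refine ⟨A * C * (2 * Real.log (A + 1) + 1) + 2 * A, by positivity, fun r hr => ?_⟩
    simp only [growthBound_zero]
    have h2 : 1 ≤ 2 * Real.log (r + 2) := by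
      have := Real.log_le_log (by norm_num) (show (2 : ℝ) ≤ r + 2 by linarith)
      have := Real.log_two_gt_d9
      linarith
    have h3 : Real.log (A * r + A + 2) ≤ Real.log (A + 1) + Real.log (r + 2) := by
      rw [← Real.log_mul (by positivity) (by positivity)]
      apply Real.log_le_log (by positivity)
      nlinarith
    have h4 : Real.log (A * r + A + 2) ≤ (2 * Real.log (A + 1) + 1) * Real.log (r + 2) := by
      nlinarith
    have h5 := mul_le_mul_of_nonneg_left h4 (show 0 ≤ A * C by positivity)
    nlinarith
  | succ n ih =>
    obtain ⟨C', hC', h⟩ := ih (A := 2 * A) (by linarith)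
    refine ⟨C', hC', fun r hr => ?_⟩
    have h0 := growthBound_nonneg n hC (show 0 ≤ A * r + A by positivity)
    have h1 := growthBound_mono n hC le_rfl (show 0 ≤ A * r + A by positivity)
      (show A * r + A ≤ 2 * A * r + 2 * A by nlinarith)
    simp only [growthBound_succ]
    have h2 : Real.log (2 * A) ≤ 2 * A :=
      (Real.log_le_sub_one_of_pos (by linarith)).trans (by linarith)
    calc A * Real.exp (growthBound n C (A * r + A)) + A
        ≤ 2 * A * Real.exp (growthBound n C (A * r + A)) := by
          nlinarith [Real.one_le_exp h0]
      _ = Real.exp (Real.log (2 * A) + growthBound n C (A * r + A)) := by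
          rw [Real.exp_add, Real.exp_log (by linarith)]
      _ ≤ _ := by
          rw [Real.exp_le_exp]
          refine le_trans ?_ (h r hr)
          nlinarith

namespace HasGrowth

variable {n : ℕ} {f g s : ℂ → ℂ}

lemma of_le {A C : ℝ} (hf : Differentiable ℂ f) (hA : 1 ≤ A) (hC : 0 ≤ C)
    (h : ∀ z, ‖f z‖ ≤ Real.exp (A * growthBound n C (A * ‖z‖ + A) + A)) : HasGrowth n f := by
  obtain ⟨C', hC', h'⟩ := exists_le_growthBound n hC hA
  exact ⟨hf, C', hC', fun z => (h z).trans (Real.exp_le_exp.2 (h' _ (norm_nonneg z)))⟩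

lemma exists_common (hf : HasGrowth n f) (hg : HasGrowth n g) : ∃ C, 0 ≤ C ∧
    (∀ z, ‖f z‖ ≤ Real.exp (growthBound n C ‖z‖)) ∧
      ∀ z, ‖g z‖ ≤ Real.exp (growthBound n C ‖z‖) := by
  obtain ⟨-, C, hC, h⟩ := hf
  obtain ⟨-, C', hC', h'⟩ := hg
  refine ⟨max C C', le_max_of_le_left hC, fun z => (h z).trans ?_, fun z => (h' z).trans ?_⟩
  · exact Real.exp_le_exp.2 (growthBound_mono n hC (le_max_left _ _) (norm_nonneg z) le_rfl)
  · exact Real.exp_le_exp.2 (growthBound_mono n hC' (le_max_right _ _) (norm_nonneg z) le_rfl)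

lemma const (n : ℕ) (c : ℂ) : HasGrowth n fun _ => c := by
  refine of_le (A := ‖c‖ + 1) (C := 0) (by fun_prop) (by linarith [norm_nonneg c]) le_rfl
    fun z => ?_
  have := growthBound_nonneg n le_rfl (show 0 ≤ (‖c‖ + 1) * ‖z‖ + (‖c‖ + 1) by positivity)
  have h2 := Real.add_one_le_exp (‖c‖ + 1)
  calc ‖c‖ ≤ Real.exp (‖c‖ + 1) := by linarith
    _ ≤ _ := Real.exp_le_exp.2 (by nlinarith [norm_nonneg c])

lemma add (hf : HasGrowth n f) (hg : HasGrowth n g) : HasGrowth n fun z => f z + g z := by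
  obtain ⟨C, hC, h, h'⟩ := exists_common hf hg
  refine of_le (A := 1) (hf.1.add hg.1) le_rfl hC fun z => ?_
  have h1 := growthBound_mono n hC le_rfl (norm_nonneg z) (show ‖z‖ ≤ 1 * ‖z‖ + 1 by linarith)
  have h2 := Real.exp_le_exp.2 h1
  have h3 := Real.add_one_le_exp (1 : ℝ)
  rw [one_mul, Real.exp_add]
  nlinarith [norm_add_le (f z) (g z), h z, h' z, Real.exp_pos (growthBound n C (1 * ‖z‖ + 1))]

lemma mul (hf : HasGrowth n f) (hg : HasGrowth n g) : HasGrowth n fun z => f z * g z := by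
  obtain ⟨C, hC, h, h'⟩ := exists_common hf hg
  refine of_le (A := 2) (hf.1.mul hg.1) (by norm_num) hC fun z => ?_
  have h1 := growthBound_mono n hC le_rfl (norm_nonneg z)
    (show ‖z‖ ≤ 2 * ‖z‖ + 2 by linarith [norm_nonneg z])
  rw [norm_mul]
  calc ‖f z‖ * ‖g z‖ ≤ Real.exp (growthBound n C ‖z‖) * Real.exp (growthBound n C ‖z‖) := by
        gcongr
        exacts [h z, h' z]
    _ = Real.exp (2 * growthBound n C ‖z‖) := by rw [← Real.exp_add, two_mul]
    _ ≤ _ := Real.exp_le_exp.2 (by linarith)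

lemma neg (hf : HasGrowth n f) : HasGrowth n fun z => -f z := by
  simpa using (const n (-1)).mul hf

lemma sub (hf : HasGrowth n f) (hg : HasGrowth n g) : HasGrowth n fun z => f z - g z := by
  simpa only [sub_eq_add_neg] using hf.add hg.neg

lemma sum {ι : Type*} {F : ι → ℂ → ℂ} (t : Finset ι) (h : ∀ i ∈ t, HasGrowth n (F i)) :
    HasGrowth n fun z => ∑ i ∈ t, F i z := by
  classical
  induction t using Finset.induction_on with
  | empty => simpa using const n 0
  | insert i t hi ih =>
    simp only [Finset.sum_insert hi]
    exact (h i (by simp)).add (ih fun j hj => h j (by simp [hj]))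

lemma id (n : ℕ) : HasGrowth n fun z => z := by
  suffices h : HasGrowth 0 fun z => z by
    induction n with
    | zero => exact h
    | succ n ih =>
      obtain ⟨hd, C, hC, hb⟩ := ih
      refine ⟨hd, C, hC, fun z => (hb z).trans (Real.exp_le_exp.2 ?_)⟩
      rw [growthBound_succ]
      linarith [Real.add_one_le_exp (growthBound n C ‖z‖)]
  refine ⟨differentiable_id, 1, zero_le_one, fun z => ?_⟩
  rw [growthBound_zero, one_mul, Real.exp_log (by positivity)]
  linarith

lemma exp (hf : HasGrowth n f) : HasGrowth (n + 1) fun z => Complex.exp (f z) := by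
  obtain ⟨hd, C, hC, hb⟩ := hf
  refine ⟨hd.cexp, C, hC, fun z => ?_⟩
  rw [growthBound_succ, Complex.norm_exp]
  exact Real.exp_le_exp.2 ((Complex.re_le_norm _).trans (hb z))

lemma succ (hf : HasGrowth n f) : HasGrowth (n + 1) f := by
  obtain ⟨hd, C, hC, hb⟩ := hf
  refine ⟨hd, C, hC, fun z => (hb z).trans (Real.exp_le_exp.2 ?_)⟩
  rw [growthBound_succ]
  linarith [Real.add_one_le_exp (growthBound n C ‖z‖)]

lemma deriv (hf : HasGrowth n f) : HasGrowth n (deriv f) := by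
  obtain ⟨hd, C, hC, hb⟩ := hf
  refine of_le (A := 1) (C := C) hd.deriv le_rfl hC fun z => ?_
  have h := Complex.norm_deriv_le_of_forall_mem_sphere_norm_le (c := z) (R := 1)
    (C := Real.exp (growthBound n C (1 * ‖z‖ + 1))) (f := f) one_pos hd.diffContOnCl fun w hw => by
      refine (hb w).trans (Real.exp_le_exp.2 (growthBound_mono n hC le_rfl (norm_nonneg w) ?_))
      have : ‖w‖ ≤ ‖w - z‖ + ‖z‖ := norm_le_norm_sub_add w z
      rw [mem_sphere_iff_norm] at hw
      linarith
  rw [div_one] at h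
  exact h.trans (Real.exp_le_exp.2 (by linarith))

/-- A consequence of the Borel–Carathéodory theorem. -/
lemma norm_le_of_exp (hs : Differentiable ℂ s) (h : HasGrowth n fun z => Complex.exp (s z)) :
    ∃ A C, 1 ≤ A ∧ 0 ≤ C ∧ ∀ z, ‖s z‖ ≤ A * growthBound n C (A * ‖z‖ + A) + A := by
  obtain ⟨-, C, hC, hb⟩ := h
  refine ⟨4 + 4 * ‖s 0‖, C, by linarith [norm_nonneg (s 0)], hC, fun z => ?_⟩
  set R := 2 * ‖z‖ + 1
  have hR : 0 < R := by positivity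
  have hg0 := growthBound_nonneg n hC hR.le
  have key := Complex.borelCaratheodory (f := s) (M := growthBound n C R + 1) (R := R) (z := z)
    (by linarith) hs.differentiableOn (fun w hw => by
      have h1 := hb w
      rw [Complex.norm_exp, Real.exp_le_exp] at h1
      have hw' : ‖w‖ ≤ R := by simpa using (Metric.mem_ball.1 hw).le
      have := growthBound_mono n hC le_rfl (norm_nonneg w) hw'
      show (s w).re ≤ _
      linarith) hR (by simp [R]; linarith [norm_nonneg z])
  have hRz : R - ‖z‖ = ‖z‖ + 1 := by simp [R]; ring
  have h1 : 2 * (growthBound n C R + 1) * ‖z‖ / (R - ‖z‖) ≤ 2 * (growthBound n C R + 1) := by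
    rw [hRz, div_le_iff₀ (by positivity)]
    nlinarith
  have h2 : ‖s 0‖ * (R + ‖z‖) / (R - ‖z‖) ≤ 3 * ‖s 0‖ := by
    rw [hRz, div_le_iff₀ (by positivity)]
    simp only [R]
    nlinarith [norm_nonneg (s 0)]
  have h3 : growthBound n C R ≤ growthBound n C ((4 + 4 * ‖s 0‖) * ‖z‖ + (4 + 4 * ‖s 0‖)) := by
    refine growthBound_mono n hC le_rfl hR.le ?_
    simp only [R]
    nlinarith [norm_nonneg (s 0), norm_nonneg z]
  nlinarith [norm_nonneg (s 0)]

lemma of_exp (hs : Differentiable ℂ s) (h : HasGrowth (n + 1) fun z => Complex.exp (s z)) :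
    HasGrowth n s := by
  obtain ⟨A, C, hA, hC, hb⟩ := norm_le_of_exp hs h
  obtain ⟨C', hC', h'⟩ := exists_le_growthBound (n + 1) hC hA
  refine ⟨hs, C', hC', fun z => ?_⟩
  rw [← growthBound_succ]
  exact (hb z).trans (h' _ (norm_nonneg z))

lemma eq_const_of_exp (hs : Differentiable ℂ s) (h : HasGrowth 0 fun z => Complex.exp (s z))
    (z w : ℂ) : s z = s w := by
  obtain ⟨A, C, hA, hC, hb⟩ := norm_le_of_exp hs h
  refine is_const_of_deriv_eq_zero hs (fun x => ?_) z w
  obtain ⟨C', hC', h'⟩ := exists_le_growthBound 0 hC hA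
  have hb' : ∀ R : ℝ, 0 < R → ‖_root_.deriv s x‖ ≤ C' * Real.log (‖x‖ + R + 2) / R := fun R hR => by
    refine Complex.norm_deriv_le_of_forall_mem_sphere_norm_le hR hs.diffContOnCl fun w hw => ?_
    have h1 := (hb w).trans (h' _ (norm_nonneg w))
    have : ‖w‖ ≤ ‖w - x‖ + ‖x‖ := norm_le_norm_sub_add w x
    rw [mem_sphere_iff_norm] at hw
    exact h1.trans (growthBound_mono 0 hC' le_rfl (norm_nonneg w) (by linarith))
  have hlim : Filter.Tendsto (fun R : ℝ => C' * Real.log (‖x‖ + R + 2) / R) Filter.atTop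
      (nhds 0) := by
    have h1 := (Real.isLittleO_log_id_atTop.comp_tendsto
      (Filter.tendsto_atTop_add_const_right Filter.atTop (‖x‖ + 2)
        Filter.tendsto_id)).tendsto_div_nhds_zero
    have h2 : Filter.Tendsto (fun R : ℝ => (R + (‖x‖ + 2)) / R) Filter.atTop (nhds 1) := by
      have := (tendsto_const_nhds (x := ‖x‖ + 2)).div_atTop
        (Filter.tendsto_id (α := ℝ) (x := Filter.atTop))
      have := this.const_add 1
      rw [add_zero] at this
      refine this.congr' ?_
      filter_upwards [Filter.eventually_gt_atTop 0] with R hR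
      simp only [_root_.id]
      field_simp
    have h3 := (h1.mul h2).const_mul C'
    rw [zero_mul, mul_zero] at h3
    refine h3.congr' ?_
    filter_upwards [Filter.eventually_gt_atTop 0] with R hR
    have : R + (‖x‖ + 2) ≠ 0 := by positivity
    simp only [Function.comp, _root_.id]
    rw [show ‖x‖ + R + 2 = R + (‖x‖ + 2) by ring]
    field_simp
  have := ge_of_tendsto hlim ((Filter.eventually_gt_atTop 0).mono hb')
  simpa using this

end HasGrowth

/-- **Jensen's inequality** for the subharmonic function `log ‖a‖`. -/
lemma log_norm_le_circleAverage {a : ℂ → ℂ} (ha : Differentiable ℂ a) {c : ℂ} (hc : a c ≠ 0)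
    {R : ℝ} (hR : 0 < R) :
    Real.log ‖a c‖ ≤ Real.circleAverage (Real.log ‖a ·‖) c R := by
  have hA : AnalyticOnNhd ℂ a (Metric.closedBall c |R|) := fun z _ => ha.analyticAt z
  rw [hA.circleAverage_log_norm hR.ne' hc]
  refine le_add_of_nonneg_left (finsum_nonneg fun u => ?_)
  by_cases hu : u ∈ Metric.closedBall c |R|
  · refine mul_nonneg ?_ ?_
    · exact_mod_cast (MeromorphicOn.AnalyticOnNhd.divisor_nonneg hA) u
    · rw [abs_of_pos hR, Metric.mem_closedBall, dist_comm, dist_eq_norm] at hu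
      rcases eq_or_ne (‖c - u‖) 0 with h | h
      · simp [h]
      · have : 0 < ‖c - u‖ := lt_of_le_of_ne (norm_nonneg _) h.symm
        exact Real.log_nonneg (by rw [← div_eq_mul_inv, one_le_div this]; exact hu)
  · simp [Function.locallyFinsuppWithin.apply_eq_zero_of_notMem _ hu]

lemma re_le_of_mul_exp_eq {a b s : ℂ → ℂ} (ha : Differentiable ℂ a) (hs : Differentiable ℂ s)
    (h : ∀ z, a z * exp (s z) = b z) {c w : ℂ} (hc : a c ≠ 0) {M : ℝ} (hM : 0 ≤ M)
    (haM : ∀ z ∈ Metric.sphere c (2 * ‖w - c‖ + 1), ‖a z‖ ≤ Real.exp M)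
    (hbM : ∀ z ∈ Metric.sphere c (2 * ‖w - c‖ + 1), ‖b z‖ ≤ Real.exp M) :
    (s w).re ≤ 3 * (2 * M - Real.log ‖a c‖) := by
  set R := 2 * ‖w - c‖ + 1 with hRdef
  have hR : 0 < R := by positivity
  have hw : w ∈ Metric.ball c R := by
    rw [mem_ball_iff_norm]; linarith [norm_nonneg (w - c)]
  have hharm : InnerProductSpace.HarmonicOnNhd (fun z => (s z).re) (Metric.closedBall c R) :=
    fun z _ => (hs.analyticAt z).harmonicAt_re
  have hpois := hharm.circleAverage_poissonKernel_smul hw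
  have hK : ∀ z ∈ Metric.sphere c R, 0 ≤ poissonKernel c w z ∧ poissonKernel c w z ≤ 3 := by
    intro z hz
    have e : poissonKernel c w z = ((z - c + (w - c)) / ((z - c) - (w - c))).re := by
      rw [poissonKernel_eq_re_herglotzRieszKernel]; rfl
    rw [e]
    refine ⟨(div_nonneg ?_ ?_).trans (le_re_herglotzRieszKernel hz hw),
      (re_herglotzRieszKernel_le hz hw).trans ?_⟩
    · linarith [norm_nonneg (w - c)]
    · positivity
    · rw [div_le_iff₀ (by linarith [norm_nonneg (w - c)])]
      linarith [norm_nonneg (w - c)]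
  set F : ℂ → ℝ := poissonKernel c w • fun z => (s z).re with hF
  have hFint : CircleIntegrable F c R := by
    refine ContinuousOn.circleIntegrable hR.le (ContinuousOn.smul ?_ ?_)
    · unfold poissonKernel
      refine ContinuousOn.div (by fun_prop) (by fun_prop) fun z hz => ?_
      have : z ≠ w := by
        rintro rfl
        rw [mem_sphere_iff_norm] at hz
        linarith [norm_nonneg (z - c)]
      simpa [sub_eq_zero] using this
    · exact (continuous_re.comp hs.continuous).continuousOn
  set G : ℂ → ℝ := fun z => if a z = 0 then 0 else F z with hG
  have hFG : F =ᶠ[Filter.codiscreteWithin (Metric.sphere c |R|)] G := by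
    have h0 : a ⁻¹' {0}ᶜ ∈ Filter.codiscrete ℂ :=
      AnalyticOnNhd.preimage_zero_mem_codiscrete (fun z _ => ha.analyticAt z) hc
    filter_upwards [Filter.codiscreteWithin_mono (Set.subset_univ _) h0] with z hz
    have : a z ≠ 0 := hz
    simp [hG, this]
  have hGint := hFint.congr_codiscreteWithin hFG
  rw [Real.circleAverage_congr_codiscreteWithin hFG hR.ne'] at hpois
  have hlogint : CircleIntegrable (Real.log ‖a ·‖) c R :=
    MeromorphicOn.circleIntegrable_log_norm fun z _ => (ha.analyticAt z).meromorphicAt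
  have hHint : CircleIntegrable (fun z => (3 : ℝ) • (2 * M - Real.log ‖a z‖)) c R :=
    ((circleIntegrable_const (2 * M) c R).sub hlogint).const_smul
  have hle : ∀ z ∈ Metric.sphere c |R|, G z ≤ (3 : ℝ) • (2 * M - Real.log ‖a z‖) := by
    intro z hz
    rw [abs_of_pos hR] at hz
    by_cases h0 : a z = 0
    · simp [hG, h0]; linarith
    · have ha0 : 0 < ‖a z‖ := norm_pos_iff.2 h0
      have h1 : Real.log ‖a z‖ ≤ M := (Real.log_le_iff_le_exp ha0).2 (haM z hz)
      have h2 : (s z).re ≤ M - Real.log ‖a z‖ := by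
        have h3 := hbM z hz
        rw [← h z, norm_mul, Complex.norm_exp, ← Real.log_le_iff_le_exp (by positivity),
          Real.log_mul ha0.ne' (Real.exp_pos _).ne', Real.log_exp] at h3
        linarith
      obtain ⟨k0, k3⟩ := hK z hz
      simp only [hG, h0, if_false]
      change poissonKernel c w z * (s z).re ≤ 3 * (2 * M - Real.log ‖a z‖)
      nlinarith
  calc (s w).re = Real.circleAverage G c R := hpois.symm
    _ ≤ Real.circleAverage (fun z => (3 : ℝ) • (2 * M - Real.log ‖a z‖)) c R :=
      Real.circleAverage_mono hGint hHint hle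
    _ = 3 * (2 * M - Real.circleAverage (Real.log ‖a ·‖) c R) := by
      rw [Real.circleAverage_fun_smul,
        Real.circleAverage_fun_sub (circleIntegrable_const (2 * M) c R) hlogint,
        Real.circleAverage_const, smul_eq_mul]
    _ ≤ _ := by linarith [log_norm_le_circleAverage ha hc hR]

namespace HasGrowth

variable {n : ℕ} {a b s : ℂ → ℂ}

lemma exp_of_mul_exp_eq (ha : HasGrowth n a) (hb : HasGrowth n b) (hs : Differentiable ℂ s)
    (h0 : a ≠ 0) (h : ∀ z, a z * Complex.exp (s z) = b z) :
    HasGrowth n fun z => Complex.exp (s z) := by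
  obtain ⟨c, hc⟩ := Function.ne_iff.1 h0
  obtain ⟨C, hC, hab, hbb⟩ := ha.exists_common hb
  set A := 6 + 3 * ‖c‖ + 3 * |Real.log ‖a c‖| with hA
  have hA6 : 6 ≤ A := by simp only [hA]; linarith [norm_nonneg c, abs_nonneg (Real.log ‖a c‖)]
  refine of_le (A := A) hs.cexp (by linarith) hC fun w => ?_
  rw [Complex.norm_exp, Real.exp_le_exp]
  have hr : 0 ≤ ‖c‖ + (2 * ‖w - c‖ + 1) := by positivity
  have hg0 := growthBound_nonneg n hC hr
  have hz : ∀ z ∈ Metric.sphere c (2 * ‖w - c‖ + 1),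
      growthBound n C ‖z‖ ≤ growthBound n C (‖c‖ + (2 * ‖w - c‖ + 1)) := fun z hz => by
    refine growthBound_mono n hC le_rfl (norm_nonneg z) ?_
    rw [mem_sphere_iff_norm] at hz
    linarith [norm_le_norm_sub_add z c]
  have key := re_le_of_mul_exp_eq ha.1 hs h hc hg0
    (fun z hz' => (hab z).trans (Real.exp_le_exp.2 (hz z hz')))
    (fun z hz' => (hbb z).trans (Real.exp_le_exp.2 (hz z hz')))
  have h2 : growthBound n C (‖c‖ + (2 * ‖w - c‖ + 1)) ≤ growthBound n C (A * ‖w‖ + A) := by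
    refine growthBound_mono n hC le_rfl hr ?_
    have := norm_sub_le w c
    nlinarith [norm_nonneg w, norm_nonneg c, abs_nonneg (Real.log ‖a c‖)]
  have := neg_abs_le (Real.log ‖a c‖)
  nlinarith [norm_nonneg c]

end HasGrowth

lemma HasGrowth.exp_sub_comm {n : ℕ} {s t : ℂ → ℂ} (hs : Differentiable ℂ s)
    (ht : Differentiable ℂ t) (h : HasGrowth n fun z => Complex.exp (s z - t z)) :
    HasGrowth n fun z => Complex.exp (t z - s z) :=
  h.exp_of_mul_exp_eq (HasGrowth.const n 1) (ht.sub hs)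
    (fun e => exp_ne_zero _ (congrFun e 0)) fun z => by simp [← Complex.exp_add]

lemma exists_eq_const_mul_of_wronskian_eq_zero {u v : ℂ → ℂ} (hu : Differentiable ℂ u)
    (hv : Differentiable ℂ v) (h0 : u ≠ 0)
    (h : ∀ z, deriv v z * u z - v z * deriv u z = 0) : ∃ c : ℂ, ∀ z, v z = c * u z := by
  obtain ⟨w, hw⟩ := Function.ne_iff.1 h0
  refine ⟨v w / u w, fun z => ?_⟩
  obtain ⟨r, hr, hball⟩ := Metric.eventually_nhds_iff_ball.1
    (hu.continuous.continuousAt.eventually_ne hw)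
  have hconst : ∀ x ∈ Metric.ball w r, v x / u x = v w / u w := by
    intro x hx
    refine Metric.isOpen_ball.is_const_of_deriv_eq_zero (𝕜 := ℂ) (f := fun x => v x / u x)
      (convex_ball w r).isPreconnected ?_ ?_ hx (Metric.mem_ball_self hr)
    · exact fun y hy => ((hv y).div (hu y) (hball y hy)).differentiableWithinAt
    · intro y hy
      rw [deriv_fun_div (hv y) (hu y) (hball y hy), h y]
      simp
  have heq : v = fun z => v w / u w * u z := by
    refine AnalyticOnNhd.eq_of_eventuallyEq (𝕜 := ℂ) (z₀ := w) (fun z _ => hv.analyticAt z)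
      (fun z _ => (hu.const_mul _).analyticAt z) ?_
    filter_upwards [Metric.ball_mem_nhds w hr] with x hx
    rw [← hconst x hx, div_mul_cancel₀ _ (hball x hx)]
  exact congrFun heq z

/-- **Borel's theorem** on linear relations between exponentials of entire functions. -/
theorem exists_hasGrowth_exp_sub {n : ℕ} {ι : Type*} (s : Finset ι) (hs : s.Nonempty)
    {a t : ι → ℂ → ℂ} (ha : ∀ i ∈ s, HasGrowth n (a i)) (ht : ∀ i ∈ s, HasGrowth n (t i))
    (ha0 : ∀ i ∈ s, a i ≠ 0) (h : ∀ z, ∑ i ∈ s, a i z * exp (t i z) = 0) :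
    ∃ i ∈ s, ∃ j ∈ s, i ≠ j ∧ HasGrowth n fun z => exp (t i z - t j z) := by
  classical
  induction s using Finset.induction_on generalizing a with
  | empty => simp at hs
  | insert k s hk ih =>
    have hk' : k ∈ insert k s := Finset.mem_insert_self k s
    have his : ∀ i ∈ s, i ∈ insert k s := fun i hi => Finset.mem_insert_of_mem hi
    rcases s.eq_empty_or_nonempty with rfl | hne
    · refine absurd (funext fun z => ?_) (ha0 k hk')
      simpa using h z
    set u : ι → ℂ → ℂ := fun i z => a i z * exp (t i z) with hu
    have hud : ∀ i ∈ insert k s, Differentiable ℂ (u i) := fun i hi =>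
      (ha i hi).1.mul (ht i hi).1.cexp
    have hu' : ∀ i ∈ insert k s, ∀ z, deriv (u i) z =
        (deriv (a i) z + a i z * deriv (t i) z) * exp (t i z) := fun i hi z => by
      have h1 := ((ha i hi).1 z).hasDerivAt.mul ((ht i hi).1 z).hasDerivAt.cexp
      exact h1.deriv.trans (by ring)
    set b : ι → ℂ → ℂ := fun i z => deriv (a i) z * a k z - a i z * deriv (a k) z +
      a i z * a k z * (deriv (t i) z - deriv (t k) z) with hb
    have hbu : ∀ i ∈ s, ∀ z, b i z * exp (t i z) * exp (t k z) =
        deriv (u i) z * u k z - u i z * deriv (u k) z := fun i hi z => by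
      rw [hu' i (his i hi), hu' k hk']
      simp only [hb, hu]
      ring
    by_cases hex : ∃ i ∈ s, b i = 0
    · obtain ⟨i, hi, hbi⟩ := hex
      have hik : i ≠ k := fun e => hk (e ▸ hi)
      have huk : u k ≠ 0 := fun e => ha0 k hk' (funext fun z => by
        simpa [hu] using congrFun e z)
      obtain ⟨c, hc⟩ := exists_eq_const_mul_of_wronskian_eq_zero (hud k hk') (hud i (his i hi)) huk
        fun z => by rw [← hbu i hi, hbi]; simp
      refine ⟨i, his i hi, k, hk', hik, HasGrowth.exp_of_mul_exp_eq (ha i (his i hi))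
        ((HasGrowth.const n c).mul (ha k hk')) ((ht i (his i hi)).1.sub (ht k hk').1)
        (ha0 i (his i hi)) fun z => ?_⟩
      have := hc z
      simp only [hu] at this
      rw [exp_sub, ← mul_div_assoc, this, ← mul_assoc, mul_div_cancel_right₀ _ (exp_ne_zero _)]
    · push Not at hex
      have hbsum : ∀ z, ∑ i ∈ s, b i z * exp (t i z) = 0 := fun z => by
        have hU : (fun z => ∑ i ∈ s, u i z) = fun z => -u k z := funext fun z => by
          have := h z
          rw [Finset.sum_insert hk] at this
          linear_combination this
        have hU' : ∑ i ∈ s, deriv (u i) z = -deriv (u k) z := by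
          rw [← deriv_fun_sum fun i hi => hud i (his i hi) z, hU, deriv.fun_neg]
        have : (∑ i ∈ s, b i z * exp (t i z)) * exp (t k z) = 0 := by
          rw [Finset.sum_mul, Finset.sum_congr rfl fun i hi => hbu i hi z, Finset.sum_sub_distrib,
            ← Finset.sum_mul, ← Finset.sum_mul, hU', congrFun hU z]
          ring
        exact (mul_eq_zero.1 this).resolve_right (exp_ne_zero _)
      have hbg : ∀ i ∈ s, HasGrowth n (b i) := fun i hi => by
        have h1 := ha i (his i hi)
        have h2 := ha k hk'
        exact ((h1.deriv.mul h2).sub (h1.mul h2.deriv)).add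
          ((h1.mul h2).mul ((ht i (his i hi)).deriv.sub (ht k hk').deriv))
      obtain ⟨i, hi, j, hj, hij, hg⟩ := ih hne hbg (fun i hi => ht i (his i hi)) hex hbsum
      exact ⟨i, his i hi, j, his j hj, hij, hg⟩

/-- A sum of exponential monomials with pairwise incomparable exponents which equals a single
monomial has at most one term. -/
theorem card_le_one_of_sum_eq_mul_exp {n : ℕ} {ι : Type*} (s : Finset ι)
    {a t : ι → ℂ → ℂ} (ha : ∀ i ∈ s, HasGrowth n (a i)) (ht : ∀ i ∈ s, HasGrowth n (t i))
    (ha0 : ∀ i ∈ s, a i ≠ 0)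
    (hts : ∀ i ∈ s, ∀ j ∈ s, i ≠ j → ¬ HasGrowth n fun z => exp (t i z - t j z))
    {b g : ℂ → ℂ} (hb : HasGrowth n b) (hg : HasGrowth n g)
    (h : ∀ z, ∑ i ∈ s, a i z * exp (t i z) = b z * exp (g z)) : s.card ≤ 1 := by
  classical
  have hempty : ∀ s' ⊆ s, ∀ a' : ι → ℂ → ℂ, (∀ i ∈ s', HasGrowth n (a' i)) →
      (∀ i ∈ s', a' i ≠ 0) → (∀ z, ∑ i ∈ s', a' i z * exp (t i z) = 0) → s' = ∅ := by
    intro s' hs' a' ha' ha0' hsum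
    by_contra hne
    obtain ⟨i, hi, j, hj, hij, hG⟩ := exists_hasGrowth_exp_sub s'
      (Finset.nonempty_iff_ne_empty.2 hne) ha' (fun i hi => ht i (hs' hi)) ha0' hsum
    exact hts i (hs' hi) j (hs' hj) hij hG
  by_cases hb0 : b = 0
  · have := hempty s subset_rfl a ha ha0 fun z => by rw [h z, hb0]; simp
    simp [this]
  have hpair : ∃ i ∈ s, HasGrowth n fun z => exp (g z - t i z) := by
    obtain ⟨i, hi, j, hj, hij, hG⟩ := exists_hasGrowth_exp_sub (n := n) (Finset.insertNone s)
      (Finset.insertNone_nonempty)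
      (a := fun o => o.elim (fun z => -b z) a) (t := fun o => o.elim g t)
      (by
        rintro (_ | i) hi
        · exact hb.neg
        · exact ha i (by simpa using hi))
      (by
        rintro (_ | i) hi
        · exact hg
        · exact ht i (by simpa using hi))
      (by
        rintro (_ | i) hi
        · exact fun e => hb0 (funext fun z => by simpa using congrFun e z)
        · exact ha0 i (by simpa using hi))
      (fun z => by
        rw [Finset.sum_insertNone]
        simp [h z])
    rcases i with _ | i <;> rcases j with _ | j
    · exact absurd rfl hij
    · exact ⟨j, by simpa using hj, hG⟩
    · have hi' : i ∈ s := by simpa using hi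
      exact ⟨i, hi', hG.exp_sub_comm (ht i hi').1 hg.1⟩
    · exact absurd hG (hts i (by simpa using hi) j (by simpa using hj) fun e => hij (by rw [e]))
  obtain ⟨k, hk, hG⟩ := hpair
  set c : ℂ → ℂ := fun z => a k z - b z * exp (g z - t k z) with hc
  have hcg : HasGrowth n c := (ha k hk).sub (hb.mul hG)
  have hck : ∀ z, c z * exp (t k z) = a k z * exp (t k z) - b z * exp (g z) := fun z => by
    simp only [hc, sub_mul, mul_assoc, ← exp_add, sub_add_cancel]
  have hsplit : ∀ z, ∑ i ∈ s.erase k, a i z * exp (t i z) = -(c z * exp (t k z)) := fun z => by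
    have := Finset.add_sum_erase s (fun i => a i z * exp (t i z)) hk
    rw [hck]
    linear_combination this + h z
  by_cases hc0 : c = 0
  · have := hempty (s.erase k) (Finset.erase_subset _ _) a
      (fun i hi => ha i (Finset.mem_of_mem_erase hi))
      (fun i hi => ha0 i (Finset.mem_of_mem_erase hi)) fun z => by rw [hsplit, hc0]; simp
    have hcard := Finset.card_erase_of_mem hk
    rw [this, Finset.card_empty] at hcard
    omega
  · refine absurd (hempty s subset_rfl (Function.update a k c) (fun i hi => ?_) (fun i hi => ?_)
      fun z => ?_) (Finset.ne_empty_of_mem hk)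
    · rcases eq_or_ne i k with rfl | hne
      · simpa using hcg
      · simpa [hne] using ha i hi
    · rcases eq_or_ne i k with rfl | hne
      · simpa using hc0
      · simpa [hne] using ha0 i hi
    · rw [← Finset.add_sum_erase s _ hk, Finset.sum_congr rfl (g := fun i => a i z * exp (t i z)),
        hsplit]
      · simp
      · intro i hi
        rw [Function.update_of_ne (Finset.ne_of_mem_erase hi)]

/-- A zero-free entire function has an entire logarithm. -/
lemma exists_exp_eq_of_ne_zero {f : ℂ → ℂ} (hf : Differentiable ℂ f) (h0 : ∀ z, f z ≠ 0) :
    ∃ g : ℂ → ℂ, Differentiable ℂ g ∧ ∀ z, f z = exp (g z) := by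
  obtain ⟨g, hg0, hg⟩ := (Differentiable.isExactOn_univ
    (hf.deriv.div hf h0)).with_val_at 0 (log (f 0))
  have hgd : Differentiable ℂ g := fun z => (hg z trivial).differentiableAt
  refine ⟨g, hgd, fun z => ?_⟩
  have hc : ∀ z, deriv (fun z => f z * exp (-g z)) z = 0 := fun z => by
    have h1 := (hf z).hasDerivAt.mul (hg z trivial).neg.cexp
    refine h1.deriv.trans ?_
    have := h0 z
    simp only [Pi.div_apply]
    field_simp
    ring
  have h2 : f z * exp (-g z) = f 0 * exp (-g 0) :=
    is_const_of_deriv_eq_zero (hf.mul hgd.neg.cexp) hc z 0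
  rw [hg0, exp_neg, exp_neg, exp_log (h0 0), mul_inv_cancel₀ (h0 0)] at h2
  exact (mul_inv_eq_one₀ (exp_ne_zero _)).1 h2

/-- The tower of rings of functions obtained from `K[z]` by repeatedly adjoining exponentials. -/
def expLevel (K : Subring ℂ) : ℕ → Subring (ℂ → ℂ)
  | 0 => Subring.closure (insert (fun z => z) ((fun c _ => c) '' (K : Set ℂ)))
  | n + 1 => Subring.closure
      (expLevel K n ∪ (fun t z => exp (t z)) '' (expLevel K n : Set (ℂ → ℂ)))

namespace expLevel

variable {K : Subring ℂ} {n : ℕ} {f t : ℂ → ℂ}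

lemma mem_succ (hf : f ∈ expLevel K n) : f ∈ expLevel K (n + 1) :=
  Subring.subset_closure (.inl hf)

lemma exp_mem (ht : t ∈ expLevel K n) : (fun z => exp (t z)) ∈ expLevel K (n + 1) :=
  Subring.subset_closure (.inr ⟨t, ht, rfl⟩)

lemma mem_of_le {m : ℕ} (h : n ≤ m) (hf : f ∈ expLevel K n) : f ∈ expLevel K m := by
  induction m, h using Nat.le_induction with
  | base => exact hf
  | succ m _ ih => exact mem_succ ih

lemma hasGrowth_of_mem_closure {S : Set (ℂ → ℂ)} (hS : ∀ f ∈ S, HasGrowth n f)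
    (hf : f ∈ Subring.closure S) : HasGrowth n f := by
  induction hf using Subring.closure_induction with
  | mem f hf => exact hS f hf
  | zero => exact HasGrowth.const n 0
  | one => exact HasGrowth.const n 1
  | add f g _ _ hf hg => exact hf.add hg
  | neg f _ hf => exact hf.neg
  | mul f g _ _ hf hg => exact hf.mul hg

lemma hasGrowth (hf : f ∈ expLevel K n) : HasGrowth n f := by
  induction n generalizing f with
  | zero =>
    refine hasGrowth_of_mem_closure ?_ hf
    rintro _ (rfl | ⟨c, -, rfl⟩)
    exacts [HasGrowth.id 0, HasGrowth.const 0 c]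
  | succ n ih =>
    refine hasGrowth_of_mem_closure ?_ hf
    rintro _ (h | ⟨t, ht, rfl⟩)
    exacts [(ih h).succ, (ih ht).exp]

lemma const_mem {c : ℂ} (hc : c ∈ K) : (fun _ => c) ∈ expLevel K n :=
  mem_of_le n.zero_le (Subring.subset_closure (.inr ⟨c, hc, rfl⟩))

lemma apply_mem_of_mem_zero (hf : f ∈ expLevel K 0) : f 0 ∈ K := by
  induction hf using Subring.closure_induction with
  | mem f hf =>
    rcases hf with rfl | ⟨c, hc, rfl⟩
    exacts [K.zero_mem, hc]
  | zero => exact K.zero_mem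
  | one => exact K.one_mem
  | add f g _ _ hf hg => exact K.add_mem hf hg
  | neg f _ hf => exact K.neg_mem hf
  | mul f g _ _ hf hg => exact K.mul_mem hf hg

/-- The exponential monomials with coefficients and exponents in level `n`. -/
def monomials (K : Subring ℂ) (n : ℕ) : Submonoid (ℂ → ℂ) where
  carrier := {f | ∃ a ∈ expLevel K n, ∃ t ∈ expLevel K n, f = fun z => a z * exp (t z)}
  one_mem' := ⟨1, one_mem _, 0, zero_mem _, by ext; simp⟩
  mul_mem' := by
    rintro _ _ ⟨a, ha, t, ht, rfl⟩ ⟨b, hb, s, hs, rfl⟩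
    refine ⟨a * b, mul_mem ha hb, t + s, add_mem ht hs, ?_⟩
    ext z
    simp only [Pi.mul_apply, Pi.add_apply, exp_add]
    ring

/-- `f` is a sum of exponential monomials over level `n` with pairwise incomparable exponents. -/
def IsReducedSum (K : Subring ℂ) (n : ℕ) (f : ℂ → ℂ) : Prop :=
  ∃ (s : Finset (ℂ → ℂ)) (a : (ℂ → ℂ) → ℂ → ℂ), (∀ t ∈ s, t ∈ expLevel K n) ∧
    (∀ t ∈ s, a t ∈ expLevel K n) ∧ (∀ t ∈ s, a t ≠ 0) ∧
    (∀ t ∈ s, ∀ u ∈ s, t ≠ u → ¬ HasGrowth n fun z => exp (t z - u z)) ∧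
    ∀ z, ∑ t ∈ s, a t z * exp (t z) = f z

/-- Reduced sums are closed under adding a monomial, provided that level `n` contains the
exponentials of its elements which have the growth of level `n`. -/
lemma IsReducedSum.monomial_add
    (hD : ∀ t ∈ expLevel K n, HasGrowth n (fun z => exp (t z)) →
      (fun z => exp (t z)) ∈ expLevel K n)
    {m : ℂ → ℂ} (hm : m ∈ monomials K n) (hf : IsReducedSum K n f) :
    IsReducedSum K n (m + f) := by
  classical
  obtain ⟨b, hb, t, ht, rfl⟩ := hm
  obtain ⟨s, a, hs, ha, ha0, hsep, hsum⟩ := hf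
  by_cases hex : ∃ u ∈ s, HasGrowth n fun z => exp (t z - u z)
  · obtain ⟨u, hu, hG⟩ := hex
    have hc : a u + b * (fun z => exp (t z - u z)) ∈ expLevel K n :=
      add_mem (ha u hu) (mul_mem hb (hD _ (sub_mem ht (hs u hu)) hG))
    set c : ℂ → ℂ := a u + b * (fun z => exp (t z - u z)) with hcdef
    have hcu : ∀ z, c z * exp (u z) = b z * exp (t z) + a u z * exp (u z) := fun z => by
      simp only [hcdef, Pi.add_apply, Pi.mul_apply, add_mul, mul_assoc, ← exp_add, sub_add_cancel]
      ring
    have hrest : ∀ z, c z * exp (u z) + ∑ t ∈ s.erase u, a t z * exp (t z) =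
        b z * exp (t z) + f z := fun z => by
      rw [← hsum, ← Finset.add_sum_erase s _ hu, hcu, add_assoc]
    by_cases hc0 : c = 0
    · refine ⟨s.erase u, a, fun v hv => hs v (Finset.mem_of_mem_erase hv),
        fun v hv => ha v (Finset.mem_of_mem_erase hv),
        fun v hv => ha0 v (Finset.mem_of_mem_erase hv),
        fun v hv w hw => hsep v (Finset.mem_of_mem_erase hv) w (Finset.mem_of_mem_erase hw),
        fun z => ?_⟩
      simpa [hc0] using hrest z
    · refine ⟨s, Function.update a u c, hs, fun v hv => ?_, fun v hv => ?_, hsep, fun z => ?_⟩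
      · rcases eq_or_ne v u with rfl | hne
        · simpa using hc
        · simpa [hne] using ha v hv
      · rcases eq_or_ne v u with rfl | hne
        · simpa using hc0
        · simpa [hne] using ha0 v hv
      · rw [← Finset.add_sum_erase s _ hu, Function.update_self]
        refine Eq.trans (congrArg _ (Finset.sum_congr rfl fun v hv => ?_)) (hrest z)
        rw [Function.update_of_ne (Finset.ne_of_mem_erase hv)]
  · push Not at hex
    by_cases hb0 : b = 0
    · refine ⟨s, a, hs, ha, ha0, hsep, fun z => ?_⟩
      simp [hb0, hsum z]
    have hts : t ∉ s := fun h => hex t h (by simpa using HasGrowth.const n 1)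
    have hne : ∀ v ∈ s, v ≠ t := fun v hv e => hts (e ▸ hv)
    refine ⟨insert t s, Function.update a t b, ?_, ?_, ?_, ?_, fun z => ?_⟩
    · exact Finset.forall_mem_insert _ _ _ |>.2 ⟨ht, hs⟩
    · refine Finset.forall_mem_insert _ _ _ |>.2 ⟨by simpa using hb, fun v hv => ?_⟩
      simpa [hne v hv] using ha v hv
    · refine Finset.forall_mem_insert _ _ _ |>.2 ⟨by simpa using hb0, fun v hv => ?_⟩
      simpa [hne v hv] using ha0 v hv
    · intro v hv w hw hvw hG
      rcases Finset.mem_insert.1 hv with rfl | hvs <;>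
        rcases Finset.mem_insert.1 hw with rfl | hws
      · exact hvw rfl
      · exact hex w hws hG
      · exact hex v hvs (hG.exp_sub_comm (hasGrowth (hs v hvs)).1 (hasGrowth ht).1)
      · exact hsep v hvs w hws hvw hG
    · rw [Finset.sum_insert hts, Function.update_self, Pi.add_apply, ← hsum]
      refine congrArg _ (Finset.sum_congr rfl fun v hv => ?_)
      rw [Function.update_of_ne (hne v hv)]

lemma isReducedSum_of_mem_succ
    (hD : ∀ t ∈ expLevel K n, HasGrowth n (fun z => exp (t z)) →
      (fun z => exp (t z)) ∈ expLevel K n)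
    (hf : f ∈ expLevel K (n + 1)) : IsReducedSum K n f := by
  have hle : Submonoid.closure
      ((expLevel K n : Set (ℂ → ℂ)) ∪ (fun t z => exp (t z)) '' (expLevel K n : Set (ℂ → ℂ))) ≤
      monomials K n := by
    rw [Submonoid.closure_le]
    rintro _ (h | ⟨t, ht, rfl⟩)
    · exact ⟨_, h, 0, zero_mem _, by ext; simp⟩
    · exact ⟨1, one_mem _, t, ht, by ext; simp⟩
  rw [expLevel, Subring.mem_closure_iff] at hf
  induction hf using AddSubgroup.closure_induction_left with
  | zero => exact ⟨∅, 0, by simp, by simp, by simp, by simp, by simp⟩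
  | add_left m hm g _ ih => exact ih.monomial_add hD (hle hm)
  | neg_add_cancel m hm g _ ih =>
    obtain ⟨a, ha, t, ht, rfl⟩ := hle hm
    exact ih.monomial_add hD ⟨-a, neg_mem ha, t, ht, by ext; simp⟩

lemma exists_eq_mul_exp
    (hD : ∀ t ∈ expLevel K n, HasGrowth n (fun z => exp (t z)) →
      (fun z => exp (t z)) ∈ expLevel K n)
    (hf : f ∈ expLevel K (n + 1)) {b g : ℂ → ℂ} (hb : HasGrowth n b) (hg : HasGrowth n g)
    (h : ∀ z, f z = b z * exp (g z)) :
    ∃ a ∈ expLevel K n, ∃ t ∈ expLevel K n, ∀ z, f z = a z * exp (t z) := by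
  obtain ⟨s, a, hs, ha, ha0, hsep, hsum⟩ := isReducedSum_of_mem_succ hD hf
  have hcard := card_le_one_of_sum_eq_mul_exp s (fun t ht => hasGrowth (ha t ht))
    (t := fun t => t) (fun t ht => hasGrowth (hs t ht)) ha0 hsep hb hg fun z => by rw [hsum, h]
  rcases Nat.le_one_iff_eq_zero_or_eq_one.1 hcard with h0 | h1
  · rw [Finset.card_eq_zero] at h0
    refine ⟨0, zero_mem _, 0, zero_mem _, fun z => ?_⟩
    rw [← hsum, h0]
    simp
  · obtain ⟨t, rfl⟩ := Finset.card_eq_one.1 h1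
    refine ⟨a t, ha t (by simp), t, hs t (by simp), fun z => ?_⟩
    rw [← hsum, Finset.sum_singleton]

lemma mem_of_hasGrowth
    (hD : ∀ t ∈ expLevel K n, HasGrowth n (fun z => exp (t z)) →
      (fun z => exp (t z)) ∈ expLevel K n)
    (hf : f ∈ expLevel K (n + 1)) (hG : HasGrowth n f) : f ∈ expLevel K n := by
  obtain ⟨a, ha, t, ht, h⟩ := exists_eq_mul_exp hD hf hG (HasGrowth.const n 0) (by simp)
  by_cases ha0 : a = 0
  · rw [show f = 0 from funext fun z => by simp [h, ha0]]
    exact zero_mem _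
  · have hexp := HasGrowth.exp_of_mul_exp_eq (hasGrowth ha) hG (hasGrowth ht).1 ha0
      fun z => (h z).symm
    rw [show f = a * fun z => exp (t z) from funext h]
    exact mul_mem ha (hD t ht hexp)

lemma exp_mem_of_hasGrowth (hK : ∀ c ∈ K, exp c ∈ K) (ht : t ∈ expLevel K n)
    (hG : HasGrowth n fun z => exp (t z)) : (fun z => exp (t z)) ∈ expLevel K n := by
  induction n generalizing t with
  | zero =>
    rw [show (fun z => exp (t z)) = fun _ => exp (t 0) from
      funext fun z => by rw [HasGrowth.eq_const_of_exp (hasGrowth ht).1 hG z 0]]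
    exact const_mem (hK _ (apply_mem_of_mem_zero ht))
  | succ n ih =>
    exact exp_mem (mem_of_hasGrowth (fun t ht => ih ht) ht
      (HasGrowth.of_exp (hasGrowth ht).1 hG))

/-- A zero-free exponential polynomial is, up to a constant, the exponential of an exponential
polynomial over the same constants. -/
theorem exists_eq_const_mul_exp (hK : ∀ c ∈ K, exp c ∈ K) (hf : f ∈ expLevel K n)
    (h0 : ∀ z, f z ≠ 0) : ∃ c : ℂ, ∃ m, ∃ t ∈ expLevel K m, ∀ z, f z = c * exp (t z) := by
  induction n generalizing f with
  | zero =>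
    obtain ⟨g, hg, hfg⟩ := exists_exp_eq_of_ne_zero (hasGrowth hf).1 h0
    have hG : HasGrowth 0 fun z => exp (g z) := funext hfg ▸ hasGrowth hf
    refine ⟨f 0, 0, 0, zero_mem _, fun z => ?_⟩
    rw [hfg, hfg, HasGrowth.eq_const_of_exp hg hG z 0]
    simp
  | succ n ih =>
    obtain ⟨g, hg, hfg⟩ := exists_exp_eq_of_ne_zero (hasGrowth hf).1 h0
    have hG : HasGrowth (n + 1) fun z => exp (g z) := funext hfg ▸ hasGrowth hf
    obtain ⟨a, ha, t, ht, h⟩ := exists_eq_mul_exp (fun t ht => exp_mem_of_hasGrowth hK ht) hf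
      (HasGrowth.const n 1) (HasGrowth.of_exp hg hG) (by simpa using hfg)
    obtain ⟨c, m, u, hu, hau⟩ := ih ha fun z hz => h0 z (by rw [h, hz, zero_mul])
    refine ⟨c, max m n, u + t, add_mem (mem_of_le (le_max_left _ _) hu)
      (mem_of_le (le_max_right _ _) ht), fun z => ?_⟩
    rw [h, hau, Pi.add_apply, exp_add, mul_assoc]

end expLevel

lemma countable_zeros_of_ne_zero {f : ℂ → ℂ} (hf : Differentiable ℂ f) {x : ℂ} (hx : f x ≠ 0) :
    {z | f z = 0}.Countable := by
  have h := AnalyticOnNhd.preimage_zero_mem_codiscrete (fun z _ => hf.analyticAt z) hx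
  rw [Set.preimage_compl, compl_mem_codiscrete_iff] at h
  have := h.2.to_subtype
  exact Set.countable_coe_iff.1 (countable_of_Lindelof_of_discrete (X := f ⁻¹' {0}))

/-- The functions of `(x, y)` generated from the coordinates and constants in `S` by ring
operations, exponentiation and restriction to `y = 0`. -/
inductive BivariateExp (S : Set ℂ) : (ℂ → ℂ → ℂ) → Prop
  | fst : BivariateExp S fun x _ => x
  | snd : BivariateExp S fun _ y => y
  | const {c : ℂ} : c ∈ S → BivariateExp S fun _ _ => c
  | add {F G : ℂ → ℂ → ℂ} : BivariateExp S F → BivariateExp S G → BivariateExp S (F + G)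
  | mul {F G : ℂ → ℂ → ℂ} : BivariateExp S F → BivariateExp S G → BivariateExp S (F * G)
  | neg {F : ℂ → ℂ → ℂ} : BivariateExp S F → BivariateExp S (-F)
  | exp {F : ℂ → ℂ → ℂ} : BivariateExp S F → BivariateExp S fun x y => Complex.exp (F x y)
  | restrict {F : ℂ → ℂ → ℂ} : BivariateExp S F → BivariateExp S fun x _ => F x 0

lemma exists_countable_closed {α : Type*} {S : Set α} (hS : S.Countable) {U : Set (α → α)}
    (hU : U.Countable) {B : Set (α → α → α)} (hB : B.Countable) :
    ∃ T : Set α, S ⊆ T ∧ T.Countable ∧ (∀ u ∈ U, ∀ a ∈ T, u a ∈ T) ∧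
      ∀ b ∈ B, ∀ a ∈ T, ∀ c ∈ T, b a c ∈ T := by
  let step : Set α → Set α := fun T => T ∪ ((⋃ u ∈ U, u '' T) ∪ ⋃ b ∈ B, Set.image2 b T T)
  have hstep : ∀ T : Set α, T.Countable → (step T).Countable := fun T hT =>
    hT.union ((hU.biUnion fun u _ => hT.image u).union (hB.biUnion fun b _ => hT.image2 hT b))
  let A : ℕ → Set α := fun n => step^[n] S
  have hsucc : ∀ n, A (n + 1) = step (A n) := fun n => Function.iterate_succ_apply' _ _ _
  have hmono : Monotone A := monotone_nat_of_le_succ fun n => by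
    rw [hsucc]
    exact Set.subset_union_left
  refine ⟨⋃ n, A n, Set.subset_iUnion A 0, Set.countable_iUnion fun n => ?_, ?_, ?_⟩
  · induction n with
    | zero => exact hS
    | succ n ih => rw [hsucc]; exact hstep _ ih
  · intro u hu a ha
    obtain ⟨n, hn⟩ := Set.mem_iUnion.1 ha
    refine Set.mem_iUnion.2 ⟨n + 1, ?_⟩
    rw [hsucc]
    exact .inr (.inl (Set.mem_biUnion hu ⟨a, hn, rfl⟩))
  · intro b hb a ha c hc
    obtain ⟨n, hn⟩ := Set.mem_iUnion.1 ha
    obtain ⟨k, hk⟩ := Set.mem_iUnion.1 hc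
    refine Set.mem_iUnion.2 ⟨max n k + 1, ?_⟩
    rw [hsucc]
    exact .inr (.inr (Set.mem_biUnion hb
      ⟨a, hmono (le_max_left n k) hn, c, hmono (le_max_right n k) hk, rfl⟩))

namespace BivariateExp

variable {S : Set ℂ} {F : ℂ → ℂ → ℂ}

lemma countable (hS : S.Countable) : {F | BivariateExp S F}.Countable := by
  obtain ⟨T, hST, hT, hU, hB⟩ := exists_countable_closed (α := ℂ → ℂ → ℂ)
    (S := {fun x _ => x, fun _ y => y} ∪ (fun c _ _ => c) '' S)
    ((Set.toFinite _).countable.union (hS.image _))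
    (U := {fun F => -F, fun F x y => Complex.exp (F x y), fun F x _ => F x 0})
    (Set.toFinite _).countable (B := {(· + ·), (· * ·)}) (Set.toFinite _).countable
  refine hT.mono fun F hF => ?_
  induction hF with
  | fst => exact hST (by simp)
  | snd => exact hST (by simp)
  | const hc => exact hST (.inr ⟨_, hc, rfl⟩)
  | add _ _ hF hG => exact hB (· + ·) (by simp) _ hF _ hG
  | mul _ _ hF hG => exact hB (· * ·) (by simp) _ hF _ hG
  | neg _ hF => exact hU (fun F => -F) (by simp) _ hF
  | exp _ hF => exact hU (fun F x y => Complex.exp (F x y)) (by simp) _ hF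
  | restrict _ hF => exact hU (fun F x _ => F x 0) (by simp) _ hF

lemma differentiable_left (hF : BivariateExp S F) (y : ℂ) :
    Differentiable ℂ fun x => F x y := by
  induction hF generalizing y with
  | fst => exact differentiable_id
  | snd => exact differentiable_const _
  | const _ => exact differentiable_const _
  | add _ _ hF hG => exact (hF y).add (hG y)
  | mul _ _ hF hG => exact (hF y).mul (hG y)
  | neg _ hF => exact (hF y).neg
  | exp _ hF => exact (hF y).cexp
  | restrict _ hF => exact hF 0

lemma zero : BivariateExp S 0 := by
  simpa using (fst (S := S)).add fst.neg

/-- The exponential ring of values at `(x, 0)`. -/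
def values (S : Set ℂ) (x : ℂ) : Subring ℂ where
  carrier := {c | ∃ F, BivariateExp S F ∧ F x 0 = c}
  mul_mem' := by
    rintro _ _ ⟨F, hF, rfl⟩ ⟨G, hG, rfl⟩
    exact ⟨_, hF.mul hG, rfl⟩
  one_mem' := ⟨_, zero.exp, Complex.exp_zero⟩
  add_mem' := by
    rintro _ _ ⟨F, hF, rfl⟩ ⟨G, hG, rfl⟩
    exact ⟨_, hF.add hG, rfl⟩
  zero_mem' := ⟨_, zero, rfl⟩
  neg_mem' := by
    rintro _ ⟨F, hF, rfl⟩
    exact ⟨_, hF.neg, rfl⟩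

lemma exp_mem_values (x : ℂ) : ∀ c ∈ values S x, Complex.exp c ∈ values S x := by
  rintro _ ⟨F, hF, rfl⟩
  exact ⟨_, hF.exp, rfl⟩

lemma exists_mem_expLevel (hF : BivariateExp S F) (x : ℂ) :
    ∃ n, F x ∈ expLevel (values S x) n := by
  induction hF with
  | fst => exact ⟨0, expLevel.const_mem ⟨_, fst, rfl⟩⟩
  | snd => exact ⟨0, Subring.subset_closure (.inl rfl)⟩
  | const hc => exact ⟨0, expLevel.const_mem ⟨_, const hc, rfl⟩⟩
  | add _ _ hF hG =>
    obtain ⟨n, hn⟩ := hF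
    obtain ⟨k, hk⟩ := hG
    exact ⟨max n k, add_mem (expLevel.mem_of_le (le_max_left _ _) hn)
      (expLevel.mem_of_le (le_max_right _ _) hk)⟩
  | mul _ _ hF hG =>
    obtain ⟨n, hn⟩ := hF
    obtain ⟨k, hk⟩ := hG
    exact ⟨max n k, mul_mem (expLevel.mem_of_le (le_max_left _ _) hn)
      (expLevel.mem_of_le (le_max_right _ _) hk)⟩
  | neg _ hF =>
    obtain ⟨n, hn⟩ := hF
    exact ⟨n, neg_mem hn⟩
  | exp _ hF =>
    obtain ⟨n, hn⟩ := hF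
    exact ⟨n + 1, expLevel.exp_mem hn⟩
  | restrict h _ => exact ⟨0, expLevel.const_mem ⟨_, h, rfl⟩⟩

lemma exists_of_mem_closure {x : ℂ} {A : Set (ℂ → ℂ)}
    (hA : ∀ f ∈ A, ∃ F, BivariateExp S F ∧ F x = f) {f : ℂ → ℂ} (hf : f ∈ Subring.closure A) :
    ∃ F, BivariateExp S F ∧ F x = f := by
  induction hf using Subring.closure_induction with
  | mem f hf => exact hA f hf
  | zero => exact ⟨0, zero, rfl⟩
  | one => exact ⟨_, zero.exp, funext fun _ => Complex.exp_zero⟩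
  | add f g _ _ hf hg =>
    obtain ⟨F, hF, rfl⟩ := hf
    obtain ⟨G, hG, rfl⟩ := hg
    exact ⟨_, hF.add hG, rfl⟩
  | neg f _ hf =>
    obtain ⟨F, hF, rfl⟩ := hf
    exact ⟨_, hF.neg, rfl⟩
  | mul f g _ _ hf hg =>
    obtain ⟨F, hF, rfl⟩ := hf
    obtain ⟨G, hG, rfl⟩ := hg
    exact ⟨_, hF.mul hG, rfl⟩

lemma exists_of_mem_expLevel {x : ℂ} {n : ℕ} {f : ℂ → ℂ} (hf : f ∈ expLevel (values S x) n) :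
    ∃ F, BivariateExp S F ∧ F x = f := by
  induction n generalizing f with
  | zero =>
    refine exists_of_mem_closure ?_ hf
    rintro _ (rfl | ⟨_, ⟨F, hF, rfl⟩, rfl⟩)
    exacts [⟨_, snd, rfl⟩, ⟨_, hF.restrict, rfl⟩]
  | succ n ih =>
    refine exists_of_mem_closure ?_ hf
    rintro _ (h | ⟨t, ht, rfl⟩)
    · exact ih h
    · obtain ⟨F, hF, rfl⟩ := ih ht
      exact ⟨_, hF.exp, rfl⟩

/-- The case of two variables. -/
theorem countable_or_countable_compl (hS : S.Countable) (hF : BivariateExp S F) :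
    {x | ∃ y, F x y = 0}.Countable ∨ {x | ∃ y, F x y = 0}ᶜ.Countable := by
  refine or_iff_not_imp_right.2 fun hE => ?_
  have hcover : {x | ∃ y, F x y = 0}ᶜ ⊆
      ⋃ T ∈ {T | BivariateExp S T}, {x | F x 0 ≠ 0 ∧
        ∀ y, F x y * Complex.exp (T x 0) - F x 0 * Complex.exp (T x y) = 0} := by
    intro x hx
    have h0 : ∀ y, F x y ≠ 0 := by simpa using hx
    obtain ⟨n, hn⟩ := hF.exists_mem_expLevel x
    obtain ⟨c, m, t, ht, h⟩ := expLevel.exists_eq_const_mul_exp (exp_mem_values x) hn h0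
    obtain ⟨T, hT, rfl⟩ := exists_of_mem_expLevel ht
    refine Set.mem_biUnion hT ⟨h0 0, fun y => ?_⟩
    rw [h, h]
    ring
  obtain ⟨T, hT, hTE⟩ : ∃ T, BivariateExp S T ∧ ¬ {x | F x 0 ≠ 0 ∧
      ∀ y, F x y * Complex.exp (T x 0) - F x 0 * Complex.exp (T x y) = 0}.Countable := by
    by_contra! h
    exact hE (((countable hS).biUnion h).mono hcover)
  have hid : ∀ x y, F x y * Complex.exp (T x 0) - F x 0 * Complex.exp (T x y) = 0 := by
    intro x y
    by_contra hne
    have hd : Differentiable ℂ fun x =>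
        F x y * Complex.exp (T x 0) - F x 0 * Complex.exp (T x y) :=
      ((hF.differentiable_left y).mul (hT.differentiable_left 0).cexp).sub
        ((hF.differentiable_left 0).mul (hT.differentiable_left y).cexp)
    exact hTE ((countable_zeros_of_ne_zero hd hne).mono fun x hx => hx.2 y)
  obtain ⟨x, hx, -⟩ : {x | F x 0 ≠ 0 ∧
      ∀ y, F x y * Complex.exp (T x 0) - F x 0 * Complex.exp (T x y) = 0}.Nonempty := by
    rw [Set.nonempty_iff_ne_empty]
    exact fun h => hTE (h ▸ Set.countable_empty)
  refine (countable_zeros_of_ne_zero (hF.differentiable_left 0) hx).mono ?_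
  rintro z ⟨y, hy⟩
  have := hid z y
  rw [hy, zero_mul, zero_sub, neg_eq_zero] at this
  exact (mul_eq_zero.1 this).resolve_right (Complex.exp_ne_zero _)

end BivariateExp

lemma exists_eq_zero_of_norm_lt {f : ℂ → ℂ} (hf : Differentiable ℂ f) {r : ℝ} (hr : 0 < r)
    (h : ∀ z ∈ Metric.sphere (0 : ℂ) r, ‖f 0‖ < ‖f z‖) : ∃ z, f z = 0 := by
  by_contra! h0
  obtain ⟨w, hw, hmin⟩ := (isCompact_sphere (0 : ℂ) r).exists_isMinOn
    (NormedSpace.sphere_nonempty.2 hr.le) hf.continuous.norm.continuousOn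
  have hle : ‖(f 0)⁻¹‖ ≤ ‖f w‖⁻¹ := by
    refine norm_le_of_forall_mem_frontier_norm_le (f := fun z => (f z)⁻¹)
      (Metric.isBounded_ball (x := (0 : ℂ)) (r := r)) (hf.inv h0).diffContOnCl (fun z hz => ?_)
      (subset_closure (Metric.mem_ball_self hr))
    rw [frontier_ball _ hr.ne'] at hz
    rw [norm_inv]
    exact inv_anti₀ (norm_pos_iff.2 (h0 w)) (hmin hz)
  rw [norm_inv, inv_le_inv₀ (norm_pos_iff.2 (h0 0)) (norm_pos_iff.2 (h0 w))] at hle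
  exact (h w hw).not_ge hle

/-- If `Q` vanishes at `p` but not identically on the line through `p` with direction `v`, then
`Q` has a zero on all nearby lines. -/
lemma eventually_exists_eq_zero_on_line {E : Type*} [NormedAddCommGroup E] [NormedSpace ℂ E]
    {Q : E → ℂ} (hQ : Differentiable ℂ Q) {p v : E} (hp : Q p = 0) (hv : Q (p + v) ≠ 0) :
    ∀ᶠ l : E × E in nhds (p, v), ∃ s : ℂ, Q (l.1 + s • l.2) = 0 := by
  have hd : ∀ l : E × E, Differentiable ℂ fun s : ℂ => Q (l.1 + s • l.2) := fun l =>
    hQ.comp (by fun_prop)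
  have hne : ∀ᶠ s in nhdsWithin (0 : ℂ) {0}ᶜ, Q (p + s • v) ≠ 0 := by
    have han : AnalyticOnNhd ℂ (fun s : ℂ => Q (p + s • v)) Set.univ :=
      fun s _ => (hd (p, v)).analyticAt s
    refine (han 0 trivial).eventually_eq_zero_or_eventually_ne_zero.resolve_left fun h => hv ?_
    simpa using han.eqOn_zero_of_preconnected_of_eventuallyEq_zero isPreconnected_univ trivial h
      (Set.mem_univ 1)
  rw [eventually_nhdsWithin_iff, Metric.eventually_nhds_iff_ball] at hne
  obtain ⟨ε, hε, hball⟩ := hne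
  have hev : ∀ᶠ l : E × E in nhds (p, v), ∀ s ∈ Metric.sphere (0 : ℂ) (ε / 2),
      ‖Q (l.1 + (0 : ℂ) • l.2)‖ < ‖Q (l.1 + s • l.2)‖ := by
    refine (isCompact_sphere (0 : ℂ) (ε / 2)).eventually_forall_of_forall_eventually
      fun s hs => ?_
    have hQc := hQ.continuous
    refine ContinuousAt.eventually_lt
      (f := fun z : (E × E) × ℂ => ‖Q (z.1.1 + (0 : ℂ) • z.1.2)‖)
      (g := fun z : (E × E) × ℂ => ‖Q (z.1.1 + z.2 • z.1.2)‖)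
      (by fun_prop) (by fun_prop) ?_
    have hs' : ‖s‖ = ε / 2 := by simpa using hs
    simp only [zero_smul, add_zero, hp, norm_zero, norm_pos_iff]
    refine hball s (by simp [hs', hε]) fun h0 => ?_
    rw [h0, norm_zero] at hs'
    linarith
  filter_upwards [hev] with l hl
  exact exists_eq_zero_of_norm_lt (hd l) (half_pos hε) hl

lemma BivariateExp.mono {S T : Set ℂ} (h : S ⊆ T) {F : ℂ → ℂ → ℂ} (hF : BivariateExp S F) :
    BivariateExp T F := by
  induction hF with
  | fst => exact fst
  | snd => exact snd
  | const hc => exact const (h hc)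
  | add _ _ hF hG => exact hF.add hG
  | mul _ _ hF hG => exact hF.mul hG
  | neg _ hF => exact hF.neg
  | exp _ hF => exact hF.exp
  | restrict _ hF => exact hF.restrict

namespace IsExpPoly

lemma differentiable {k : ℕ} {P : (Fin k → ℂ) → ℂ} (hP : IsExpPoly P) : Differentiable ℂ P := by
  induction hP with
  | proj i => fun_prop
  | const c => fun_prop
  | add _ _ hf hg => exact hf.add hg
  | mul _ _ hf hg => exact hf.mul hg
  | exp _ hf => exact hf.cexp

lemma exists_bivariateExp {m : ℕ} {P : (Fin (m + 1) → ℂ) → ℂ} (hP : IsExpPoly P)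
    (p v : Fin m → ℂ) : ∃ S : Set ℂ, S.Countable ∧
      BivariateExp S fun x s => P (Fin.cons x (p + s • v)) := by
  induction hP with
  | proj i =>
    cases i using Fin.cases with
    | zero => exact ⟨∅, Set.countable_empty, .fst⟩
    | succ i =>
      refine ⟨{p i, v i}, (Set.toFinite _).countable, ?_⟩
      exact (BivariateExp.const (by simp)).add (.mul .snd (.const (by simp)))
  | const c => exact ⟨{c}, Set.countable_singleton c, .const rfl⟩
  | add _ _ hf hg =>
    obtain ⟨S, hS, hf⟩ := hf
    obtain ⟨T, hT, hg⟩ := hg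
    exact ⟨S ∪ T, hS.union hT,
      (hf.mono Set.subset_union_left).add (hg.mono Set.subset_union_right)⟩
  | mul _ _ hf hg =>
    obtain ⟨S, hS, hf⟩ := hf
    obtain ⟨T, hT, hg⟩ := hg
    exact ⟨S ∪ T, hS.union hT,
      (hf.mono Set.subset_union_left).mul (hg.mono Set.subset_union_right)⟩
  | exp _ hf =>
    obtain ⟨S, hS, hf⟩ := hf
    exact ⟨S, hS, hf.exp⟩

end IsExpPoly

/-- Boxall: for an exponential polynomial `P : ℂ^{1+m} → ℂ`, the
set `X = {x ∈ ℂ : ∃ ȳ, P(x,ȳ) = 0}` is countable or co-countable. -/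
theorem existential_exp_set_countable_or_cocountable (m : ℕ)
    (P : (Fin (m + 1) → ℂ) → ℂ) (hP : IsExpPoly P) :
    {x : ℂ | ∃ y : Fin m → ℂ, P (Fin.cons x y) = 0}.Countable ∨
      {x : ℂ | ∃ y : Fin m → ℂ, P (Fin.cons x y) = 0}ᶜ.Countable := by
  obtain ⟨D, hD, hdense⟩ := TopologicalSpace.exists_countable_dense ((Fin m → ℂ) × (Fin m → ℂ))
  refine or_iff_not_imp_right.2 fun hX => ?_
  have hline : ∀ l ∈ D, {x | ∃ s : ℂ, P (Fin.cons x (l.1 + s • l.2)) = 0}.Countable := by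
    intro l _
    obtain ⟨S, hS, hF⟩ := hP.exists_bivariateExp l.1 l.2
    refine (hF.countable_or_countable_compl hS).resolve_right fun h => hX (h.mono ?_)
    exact Set.compl_subset_compl.2 fun x ⟨s, hs⟩ => ⟨_, hs⟩
  refine (hD.biUnion hline).mono ?_
  rintro x ⟨y, hy⟩
  suffices h : ∃ l ∈ D, ∃ s : ℂ, P (Fin.cons x (l.1 + s • l.2)) = 0 by
    simpa using h
  by_cases h0 : ∀ y : Fin m → ℂ, P (Fin.cons x y) = 0
  · obtain ⟨l, hl⟩ := hdense.nonempty
    exact ⟨l, hl, 0, h0 _⟩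
  · push Not at h0
    obtain ⟨w, hw⟩ := h0
    have hQ : Differentiable ℂ fun y : Fin m → ℂ => P (Fin.cons x y) := by
      refine hP.differentiable.comp (differentiable_pi.2 fun i => ?_)
      cases i using Fin.cases with
      | zero => exact differentiable_const x
      | succ i => exact differentiable_apply i
    have hev := eventually_exists_eq_zero_on_line hQ (v := w - y) hy
      (by rwa [add_sub_cancel])
    obtain ⟨l, hlD, hl⟩ := hdense.inter_nhds_nonempty hev
    exact ⟨l, hlD, hl⟩
end

section
/- Let n ≥ 1 and let V ⊆ ℂ^n × (ℂ*)^n be an irreducible algebraic variety such that the projection π₁(V) of V to the first n coordinates is Zariski dense in ℂ^n. Then V is rotund: for every nonzero n × n matrix M with integer entries, the image M·V = {(M·x̄, ȳ^M) : (x̄, ȳ) ∈ V} satisfies dim(M·V) ≥ rank(M). -/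
open MvPolynomial Complex

section KrullDimension

/-- An integral extension of rings with trivial kernel does not lower the Krull dimension. -/
theorem ringKrullDim_le_of_isIntegral_of_injective {R S : Type*} [CommRing R] [CommRing S]
    [Algebra R S] [Algebra.IsIntegral R S] (hinj : Function.Injective (algebraMap R S)) :
    ringKrullDim R ≤ ringKrullDim S := by
  refine iSup_le fun l ↦ ?_
  obtain ⟨Q, -, hQ, hQl⟩ := Ideal.exists_ideal_over_prime_of_isIntegral
    l.head.asIdeal (⊥ : Ideal S) (by simp [Ideal.comap_bot_of_injective _ hinj])
  have : Q.LiesOver l.head.asIdeal := ⟨hQl.symm⟩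
  obtain ⟨L, hL, -⟩ := Ideal.exists_ltSeries_of_hasGoingUp (S := S) l Q
  exact hL ▸ le_iSup (fun p : LTSeries (PrimeSpectrum S) ↦ (p.length : WithBot ℕ∞)) L

/-- The cardinality of an algebraically independent family in a finitely generated domain over a
field is at most the Krull dimension. -/
theorem AlgebraicIndependent.natCard_le_ringKrullDim {k A ι : Type*} [Field k] [CommRing A]
    [IsDomain A] [Algebra k A] [Algebra.FiniteType k A] [Finite ι] {x : ι → A}
    (hx : AlgebraicIndependent k x) : (Nat.card ι : WithBot ℕ∞) ≤ ringKrullDim A := by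
  obtain ⟨s, g, hinj, hint⟩ := exists_integral_inj_algHom_of_fg k A
  algebraize [g.toRingHom]
  have hcard : Nat.card ι ≤ s := by
    have : FaithfulSMul (MvPolynomial (Fin s) k) A :=
      (faithfulSMul_iff_algebraMap_injective _ _).mpr hinj
    have : IsScalarTower k (MvPolynomial (Fin s) k) A :=
      .of_algebraMap_eq fun r ↦ (g.commutes r).symm
    have htrdeg := lift_trdeg_add_eq k (MvPolynomial (Fin s) k) A
    rw [trdeg_eq_zero (R := MvPolynomial (Fin s) k), MvPolynomial.trdeg_of_isDomain] at htrdeg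
    have htrdeg' : Algebra.trdeg k A = s := by simpa using htrdeg.symm
    have hle := hx.lift_cardinalMk_le_trdeg
    rw [htrdeg', ← Nat.cast_card] at hle
    simpa using hle
  calc (Nat.card ι : WithBot ℕ∞) ≤ (s : WithBot ℕ∞) := by exact_mod_cast hcard
    _ = ringKrullDim (MvPolynomial (Fin s) k) := by simp
    _ ≤ ringKrullDim A := ringKrullDim_le_of_isIntegral_of_injective hinj

/-- If a finite family is algebraically independent modulo an ideal `I`, then some prime ideal
containing `I` has a quotient whose Krull dimension is at least the cardinality of the family. -/
theorem AlgebraicIndependent.exists_isPrime_natCard_le_ringKrullDim_quotient {k R ι : Type*}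
    [Field k] [CommRing R] [Algebra k R] [Algebra.FiniteType k R] [Finite ι] (I : Ideal R)
    {x : ι → R} (hx : AlgebraicIndependent k (Ideal.Quotient.mk I ∘ x)) :
    ∃ P : Ideal R, P.IsPrime ∧ I ≤ P ∧ (Nat.card ι : WithBot ℕ∞) ≤ ringKrullDim (R ⧸ P) := by
  have hker : I.comap (MvPolynomial.aeval x : MvPolynomial ι k →ₐ[k] R).toRingHom = ⊥ := by
    rw [eq_bot_iff]
    intro p hp
    refine hx.eq_zero_of_aeval_eq_zero p ?_
    have : (MvPolynomial.aeval (Ideal.Quotient.mk I ∘ x) p : R ⧸ I) =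
        Ideal.Quotient.mkₐ k I (MvPolynomial.aeval x p) :=
      (MvPolynomial.comp_aeval_apply x (Ideal.Quotient.mkₐ k I) p).symm
    rw [this]
    exact Ideal.Quotient.eq_zero_iff_mem.mpr hp
  obtain ⟨P, hP, hIP, hPx⟩ := Ideal.exists_comap_eq_of_mem_minimalPrimes (I := I)
    (MvPolynomial.aeval x : MvPolynomial ι k →ₐ[k] R).toRingHom ⊥
    (by rw [hker, Ideal.minimalPrimes_eq_subsingleton_self]; rfl)
  refine ⟨P, hP, hIP, ?_⟩
  have hind : AlgebraicIndependent k (Ideal.Quotient.mk P ∘ x) := by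
    rw [algebraicIndependent_iff]
    intro p hp
    have : (MvPolynomial.aeval (Ideal.Quotient.mk P ∘ x) p : R ⧸ P) =
        Ideal.Quotient.mkₐ k P (MvPolynomial.aeval x p) :=
      (MvPolynomial.comp_aeval_apply x (Ideal.Quotient.mkₐ k P) p).symm
    rw [this] at hp
    have : p ∈ P.comap (MvPolynomial.aeval x : MvPolynomial ι k →ₐ[k] R).toRingHom :=
      Ideal.mem_comap.mpr (Ideal.Quotient.eq_zero_iff_mem.mp hp)
    rwa [hPx] at this
  exact hind.natCard_le_ringKrullDim

end KrullDimension

section ZariskiDimension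

theorem isZClosed_zeroLocus {σ : Type} (I : Ideal (MvPolynomial σ ℂ)) :
    IsZClosed (zeroLocus ℂ I) :=
  ⟨I, by ext; simp [zeroSet, MvPolynomial.aeval_eq_eval]⟩

theorem isZIrreducible_zeroLocus {σ : Type} [Finite σ] (P : Ideal (MvPolynomial σ ℂ))
    [hP : P.IsPrime] : IsZIrreducible (zeroLocus ℂ P) := by
  constructor
  · rw [Set.nonempty_iff_ne_empty]
    intro h
    have := IsPrime.vanishingIdeal_zeroLocus (K := ℂ) P
    rw [h, vanishingIdeal_empty] at this
    exact hP.ne_top this.symm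
  · rintro _ _ ⟨T₁, rfl⟩ ⟨T₂, rfl⟩ h
    by_contra! hn
    obtain ⟨h₁, h₂⟩ := hn
    simp only [Set.not_subset, zeroSet, Set.mem_ofPred_eq, not_forall] at h₁ h₂
    obtain ⟨x, hx, p, hp, hpx⟩ := h₁
    obtain ⟨y, hy, q, hq, hqy⟩ := h₂
    have hpq : p * q ∈ P := by
      rw [← IsPrime.vanishingIdeal_zeroLocus (K := ℂ) P]
      intro z hz
      rcases h hz with hz | hz
      · simp [MvPolynomial.aeval_eq_eval, hz p hp]
      · simp [MvPolynomial.aeval_eq_eval, hz q hq]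
    rcases hP.mem_or_mem hpq with h' | h'
    · exact hpx (hx p h')
    · exact hqy (hy q h')

theorem zeroLocus_subset_zClosure {σ : Type} {s : Set (σ → ℂ)} {I : Ideal (MvPolynomial σ ℂ)}
    (h : vanishingIdeal ℂ s ≤ I) : zeroLocus ℂ I ⊆ zClosure s := by
  rintro x hx _ ⟨⟨T, rfl⟩, hs⟩ p hp
  exact hx p (h fun y hy ↦ hs hy p hp)

/-- The dimension of a set is at least the Krull dimension of any quotient of the polynomial ring
by an ideal containing the vanishing ideal of the set. -/
theorem ringKrullDim_quotient_le_zdim {σ : Type} [Finite σ] {s : Set (σ → ℂ)}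
    {I : Ideal (MvPolynomial σ ℂ)} (h : vanishingIdeal ℂ s ≤ I) :
    ringKrullDim (MvPolynomial σ ℂ ⧸ I) ≤ zdim s := by
  rw [ringKrullDim_quotient, zdim, ← Order.krullDim_orderDual]
  refine Order.krullDim_le_of_strictMono
    (fun P ↦ ⟨zeroLocus ℂ (OrderDual.ofDual P).1.asIdeal, isZClosed_zeroLocus _,
      isZIrreducible_zeroLocus _, zeroLocus_subset_zClosure (h.trans (OrderDual.ofDual P).2)⟩) ?_
  refine Monotone.strictMono_of_injective (fun P Q hPQ ↦ zeroLocus_anti_mono hPQ) fun P Q hPQ ↦ ?_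
  have := congrArg (vanishingIdeal ℂ) (congrArg Subtype.val hPQ)
  simp only [IsPrime.vanishingIdeal_zeroLocus] at this
  exact Subtype.ext (PrimeSpectrum.ext this)

/-- A set with a Zariski dense projection to some of the coordinates has dimension at least the
number of these coordinates. -/
theorem IsZDense.natCard_le_zdim {σ ι : Type} [Finite σ] [Finite ι] {s : Set (σ → ℂ)} (e : ι → σ)
    (h : IsZDense ((fun v ↦ v ∘ e) '' s)) : (Nat.card ι : WithBot ℕ∞) ≤ zdim s := by
  have hind : AlgebraicIndependent ℂ
      (Ideal.Quotient.mk (vanishingIdeal ℂ s) ∘ fun i ↦ (X (e i) : MvPolynomial σ ℂ)) := by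
    rw [algebraicIndependent_iff]
    intro p hp
    have haeval : aeval (Ideal.Quotient.mk (vanishingIdeal ℂ s) ∘ fun i ↦ X (e i)) p =
        Ideal.Quotient.mkₐ ℂ (vanishingIdeal ℂ s) (rename e p) :=
      DFunLike.congr_fun (f := aeval _) (g := (Ideal.Quotient.mkₐ ℂ _).comp (rename e))
        (algHom_ext fun i ↦ by simp) p
    rw [haeval] at hp
    refine h p ?_
    rintro _ ⟨v, hv, rfl⟩
    have := (Ideal.Quotient.eq_zero_iff_mem.mp hp : rename e p ∈ vanishingIdeal ℂ s) v hv
    rwa [aeval_rename, MvPolynomial.aeval_eq_eval] at this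
  obtain ⟨P, -, hP, hle⟩ := hind.exists_isPrime_natCard_le_ringKrullDim_quotient
  exact hle.trans (ringKrullDim_quotient_le_zdim hP)

end ZariskiDimension

section LinearMaps

/-- The image of a Zariski dense set under a surjective linear map is Zariski dense. -/
theorem IsZDense.image_mulVec {ι κ : Type} [Fintype ι] [Finite κ] {s : Set (ι → ℂ)}
    (hs : IsZDense s) {N : Matrix κ ι ℂ} (hN : Function.Surjective N.mulVec) :
    IsZDense (N.mulVec '' s) := by
  intro p hp
  have heval (x : ι → ℂ) :
      eval x (bind₁ (fun i ↦ ∑ j, C (N i j) * X j) p) = eval (N.mulVec x) p := by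
    rw [← MvPolynomial.aeval_eq_eval, aeval_bind₁, MvPolynomial.aeval_eq_eval]
    simp only [map_sum, map_mul, aeval_C, aeval_X]
    rfl
  have hzero := hs _ fun x hx ↦ (heval x).trans (hp _ ⟨x, hx, rfl⟩)
  refine MvPolynomial.funext fun y ↦ ?_
  obtain ⟨x, rfl⟩ := hN y
  rw [← heval, hzero, map_zero, map_zero]

/-- A matrix has `rank`-many rows forming a matrix with a right inverse. -/
theorem Matrix.exists_submatrix_mul_eq_one {m n K : Type*} [Finite m] [Fintype n] [Field K]
    (M : Matrix m n K) : ∃ (e : Fin M.rank → m) (B : Matrix n (Fin M.rank) K),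
      M.submatrix e id * B = 1 := by
  obtain ⟨κ, a, ha, hspan, hind⟩ := exists_linearIndependent' K M.row
  have : Finite κ := .of_injective a ha
  have : Fintype κ := .ofFinite κ
  have hcard : Fintype.card κ = M.rank := by
    rw [← hind.rank_matrix (M := M.submatrix a id), Matrix.rank_eq_finrank_span_row,
      Matrix.rank_eq_finrank_span_row, ← hspan]
    rfl
  let f : Fin M.rank ≃ κ := (Fintype.equivFinOfCardEq hcard).symm
  have hrank : (M.submatrix (a ∘ f) id).rank = M.rank := by
    simpa using (hind.comp f f.injective).rank_matrix (M := M.submatrix (a ∘ f) id)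
  refine ⟨a ∘ f, Matrix.mulVec_surjective_iff_exists_right_inverse.mp ?_⟩
  have htop : (M.submatrix (a ∘ f) id).mulVecLin.range = ⊤ :=
    Submodule.eq_top_of_finrank_eq (by rw [Module.finrank_fin_fun]; exact hrank)
  exact LinearMap.range_eq_top.mp htop

end LinearMaps

/-- an irreducible algebraic variety `V ⊆ ℂ^n × (ℂ*)^n` whose
projection to the first `n` coordinates is Zariski dense in `ℂ^n` is rotund:
for every nonzero integer `n × n` matrix `M`,
`dim M·V ≥ rank M`, where `M·V = {(M·x̄, ȳ^M) : (x̄,ȳ) ∈ V}`. -/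
theorem rotund_of_dominant_first_projection (n : ℕ) (hn : 1 ≤ n)
    (V : Set (Fin n ⊕ Fin n → ℂ))
    (hV : ∃ T : Set (MvPolynomial (Fin n ⊕ Fin n) ℂ),
      V = zeroSet T ∩ {v | ∀ i, v (Sum.inr i) ≠ 0})
    (hVirr : IsZIrreducible V)
    (hdom : IsZDense {x : Fin n → ℂ | ∃ v ∈ V, x = fun i => v (Sum.inl i)}) :
    ∀ M : Matrix (Fin n) (Fin n) ℤ, M ≠ 0 →
      ((M.map ((↑) : ℤ → ℚ)).rank : WithBot ℕ∞) ≤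
        zdim {w : Fin n ⊕ Fin n → ℂ | ∃ v ∈ V,
          w = Sum.elim (fun i => ∑ j, (M i j : ℂ) * v (Sum.inl j))
                       (fun i => ∏ j, v (Sum.inr j) ^ M i j)} := by
  intro M _
  obtain ⟨e, B, hB⟩ := (M.map ((↑) : ℤ → ℚ)).exists_submatrix_mul_eq_one
  have hsurj : Function.Surjective ((M.submatrix e id).map ((↑) : ℤ → ℂ)).mulVec := by
    refine Matrix.mulVec_surjective_iff_exists_right_inverse.mpr ⟨B.map (algebraMap ℚ ℂ), ?_⟩
    have h := congrArg (fun N ↦ N.map (algebraMap ℚ ℂ)) hB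
    simp only [Matrix.map_mul] at h
    rw [Matrix.map_one _ (map_zero _) (map_one _)] at h
    rw [← h]
    congr 1
  have hdense := hdom.image_mulVec hsurj
  rw [← Nat.card_fin (M.map ((↑) : ℤ → ℚ)).rank]
  refine IsZDense.natCard_le_zdim (fun i ↦ Sum.inl (e i)) ?_
  refine fun p hp ↦ hdense p ?_
  rintro _ ⟨_, ⟨v, hv, rfl⟩, rfl⟩
  exact hp _ ⟨_, ⟨v, hv, rfl⟩, rfl⟩
end

section
/- Assume Schanuel's Conjecture. Let ā = (a₁,…,aₙ) ∈ ℂ^n and suppose that the transcendence degree of ℚ(a₁,…,aₙ, e^{a₁},…,e^{aₙ}) over ℚ equals m, and that each e^{aᵢ} is algebraic over ℚ(a₁,…,aₙ) and each aᵢ is algebraic over ℚ(e^{a₁},…,e^{aₙ}). Then the dimension of the ℚ-vector space spanned by a₁,…,aₙ equals m; in particular, if m < n there exists an (n−m) × n integer matrix M of rank n−m with M·ā = 0. -/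
open MvPolynomial Complex

/-- The size of a `ℚ`-algebraically independent set consisting of elements algebraic over `ℚ(t)`
is at most the size of `t`. -/
theorem card_le_card_of_isAlgebraic_adjoin {s t : Finset ℂ}
    (hs : AlgebraicIndependent ℚ (Subtype.val : ↥(s : Set ℂ) → ℂ))
    (h : ∀ x ∈ s, IsAlgebraic (IntermediateField.adjoin ℚ (t : Set ℂ)) x) :
    s.card ≤ t.card := by
  let N := AlgebraicIndependent.matroid ℚ ℂ
  have hsub : (s : Set ℂ) ⊆ N.closure t := fun x hx ↦ by
    rw [AlgebraicIndependent.matroid_closure_eq]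
    exact IntermediateField.isAlgebraic_adjoin_iff.mp (h x hx)
  have hind : N.Indep s := AlgebraicIndependent.matroid_indep_iff.mpr hs
  have hle : (s : Set ℂ).encard ≤ (t : Set ℂ).encard := by
    rw [← hind.eRk_eq_encard]
    exact ((N.eRk_mono hsub).trans (N.eRk_closure_eq t).le).trans (N.eRk_le_encard t)
  simpa only [Set.encard_coe_eq_coe_finsetCard, Nat.cast_le] using hle

/-- Subsets of an algebra with the same linear span generate the same field extension. -/
theorem adjoin_eq_adjoin_of_span_eq_span {F E : Type*} [Field F] [Field E] [Algebra F E]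
    {s t : Set E} (h : Submodule.span F s = Submodule.span F t) :
    IntermediateField.adjoin F s = IntermediateField.adjoin F t := by
  have key : ∀ u v : Set E, Submodule.span F u = Submodule.span F v →
      IntermediateField.adjoin F u ≤ IntermediateField.adjoin F v := fun u v huv ↦
    IntermediateField.adjoin_le_iff.mpr fun x hx ↦
      IntermediateField.algebra_adjoin_le_adjoin F v <|
        Algebra.span_le_adjoin F v <| huv ▸ Submodule.subset_span hx
  exact le_antisymm (key s t h) (key t s h.symm)

/-- A family of `n` vectors whose span has dimension `d` satisfies `n - d` independent linear
relations with integer coefficients. -/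
theorem exists_int_matrix_rank_eq_sub_finrank_span {n : ℕ} (a : Fin n → ℂ) :
    ∃ M : Matrix (Fin (n - Module.finrank ℚ (Submodule.span ℚ (Set.range a)))) (Fin n) ℤ,
      (M.map ((↑) : ℤ → ℚ)).rank =
        n - Module.finrank ℚ (Submodule.span ℚ (Set.range a)) ∧
      ∀ i, ∑ j, (M i j : ℂ) * a j = 0 := by
  set d := Module.finrank ℚ (Submodule.span ℚ (Set.range a))
  let f := Fintype.linearCombination ℚ a
  have hker : Module.finrank ℚ (LinearMap.ker f) = n - d := by
    have h := LinearMap.finrank_range_add_finrank_ker f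
    rw [Fintype.range_linearCombination, Module.finrank_fin_fun] at h
    omega
  let b := Module.finBasisOfFinrankEq ℚ (LinearMap.ker f) hker
  obtain ⟨c, hc⟩ := IsLocalization.exist_integer_multiples_of_finite (nonZeroDivisors ℤ)
    fun p : Fin (n - d) × Fin n ↦ (b p.1 : Fin n → ℚ) p.2
  choose M hM using hc
  have hc0 : ((c : ℤ) : ℚ) ≠ 0 := Int.cast_ne_zero.mpr (nonZeroDivisors.coe_ne_zero c)
  have hMb : ∀ i j, (M (i, j) : ℚ) = ((c : ℤ) : ℚ) * (b i : Fin n → ℚ) j := fun i j ↦ by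
    have h := hM (i, j)
    rw [eq_intCast, zsmul_eq_mul] at h
    exact h
  refine ⟨Matrix.of fun i j ↦ M (i, j), ?_, fun i ↦ ?_⟩
  · have hb : LinearIndependent ℚ fun i ↦ (b i : Fin n → ℚ) :=
      b.linearIndependent.map' (LinearMap.ker f).subtype (Submodule.ker_subtype _)
    have hrow := hb.units_smul fun _ ↦ Units.mk0 _ hc0
    have heq : ((Matrix.of fun i j ↦ M (i, j)).map ((↑) : ℤ → ℚ)).row =
        (fun _ : Fin (n - d) ↦ Units.mk0 _ hc0) • fun i ↦ (b i : Fin n → ℚ) := by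
      ext i j
      simp [hMb, Units.smul_def]
    exact (LinearIndependent.rank_matrix (heq ▸ hrow)).trans (Fintype.card_fin _)
  · have hrel : ∑ j, (((b i : Fin n → ℚ) j : ℚ) : ℂ) * a j = 0 := by
      have h : f (b i) = 0 := (b i).2
      rw [Fintype.linearCombination_apply] at h
      simpa only [Rat.smul_def] using h
    have hMC : ∀ j, (M (i, j) : ℂ) = ((c : ℤ) : ℂ) * (((b i : Fin n → ℚ) j : ℚ) : ℂ) :=
      fun j ↦ by exact_mod_cast congrArg ((↑) : ℚ → ℂ) (hMb i j)
    simp only [Matrix.of_apply, hMC, mul_assoc]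
    rw [← Finset.mul_sum, hrel, mul_zero]

/-- assume Schanuel's Conjecture.  If
`trdeg ℚ(ā, e^ā)/ℚ = m`, each `e^{aᵢ}` is algebraic over `ℚ(ā)` and each `aᵢ`
is algebraic over `ℚ(e^ā)`, then the `ℚ`-vector space spanned by `a₁,…,aₙ` has
dimension `m`; in particular, if `m < n`, there is an `(n-m) × n` integer
matrix `M` of rank `n - m` with `M·ā = 0`. -/
theorem linear_dimension_eq_of_interalgebraic
    (hSC : SchanuelConjecture) (n m : ℕ) (a : Fin n → ℂ)
    (htd : TrdegEq ℚ (Set.range a ∪ Set.range fun i => exp (a i)) m)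
    (halg₁ : ∀ i, IsAlgebraic
      ↥(IntermediateField.adjoin ℚ (Set.range a)) (exp (a i)))
    (halg₂ : ∀ i, IsAlgebraic
      ↥(IntermediateField.adjoin ℚ (Set.range fun i => exp (a i))) (a i)) :
    Module.finrank ℚ ↥(Submodule.span ℚ (Set.range a)) = m ∧
    (m < n → ∃ M : Matrix (Fin (n - m)) (Fin n) ℤ,
      (M.map ((↑) : ℤ → ℚ)).rank = n - m ∧
      ∀ i, ∑ j, (M i j : ℂ) * a j = 0) := by
  have hdim : Module.finrank ℚ ↥(Submodule.span ℚ (Set.range a)) = m := by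
    obtain ⟨t, ht, rfl, htind, htalg⟩ := htd
    apply le_antisymm
    · obtain ⟨s, hs, hscard, hsind⟩ := hSC n a
      rw [← hscard]
      exact card_le_card_of_isAlgebraic_adjoin hsind fun x hx ↦ htalg x (hs hx)
    · have := Module.Finite.span_of_finite ℚ (Set.finite_range a)
      obtain ⟨B, -, hBcard, hBspan, -⟩ :=
        Submodule.exists_finset_span_eq_linearIndepOn ℚ (Set.range a)
      rw [← hBcard]
      refine card_le_card_of_isAlgebraic_adjoin htind fun x hx ↦ ?_
      rw [adjoin_eq_adjoin_of_span_eq_span hBspan]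
      rcases ht hx with hxa | ⟨i, rfl⟩
      · exact isAlgebraic_algebraMap
          (⟨x, IntermediateField.subset_adjoin ℚ _ hxa⟩ : IntermediateField.adjoin ℚ (Set.range a))
      · exact halg₁ i
  refine ⟨hdim, fun _ ↦ ?_⟩
  subst hdim
  exact exists_int_matrix_rank_eq_sub_finrank_span a
end
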